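/- arXiv:1301.7718 — 2 statements merged into one kernel-verified Lean document; each statement's English description precedes it below -/
import Mathlib

section
/- There exists an absolute constant C ≥ 1 such that the following holds (Helfgott's theorem). Let p be a prime, let K ≥ 2 be a real number, and let A be a finite nonempty subset of SL₂(F_p) with |A·A| ≤ K·|A|. Then either |A| ≥ K^(−C)·|SL₂(F_p)|, or there exist a subset A′ ⊆ A with |A′| ≥ K^(−C)·|A| and a solvable subgroup H of SL₂(F_p) such that A′ ⊆ H. -/
open Pointwise

namespace SLTwo

/-- The group of `2 × 2` matrices of determinant `1`. -/
abbrev SL2 (F : Type*) [CommRing F] := Matrix.SpecialLinearGroup (Fin 2) F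

section Algebra

variable {F : Type*} [Field F]

/-- The trace of an element of `SL₂`. -/
def tr (g : SL2 F) : F := g 0 0 + g 1 1

/-- An element of `SL₂` is scalar if it is a scalar matrix. -/
def IsScalar (g : SL2 F) : Prop := g 0 1 = 0 ∧ g 1 0 = 0 ∧ g 0 0 = g 1 1

lemma det_eq (g : SL2 F) : g 0 0 * g 1 1 - g 0 1 * g 1 0 = 1 := by
  rw [← Matrix.det_fin_two, g.2]

lemma mul_entry (g h : SL2 F) (i j : Fin 2) :
    (g * h) i j = g i 0 * h 0 j + g i 1 * h 1 j := by
  simp [Matrix.mul_apply, Fin.sum_univ_two]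

lemma inv_entries (g : SL2 F) :
    g⁻¹ 0 0 = g 1 1 ∧ g⁻¹ 0 1 = - g 0 1 ∧ g⁻¹ 1 0 = - g 1 0 ∧ g⁻¹ 1 1 = g 0 0 := by
  simp [Matrix.SpecialLinearGroup.coe_inv, Matrix.adjugate_fin_two]

lemma ext_entries {g h : SL2 F} (h00 : g 0 0 = h 0 0) (h01 : g 0 1 = h 0 1)
    (h10 : g 1 0 = h 1 0) (h11 : g 1 1 = h 1 1) : g = h := by
  ext i j
  fin_cases i <;> fin_cases j <;> assumption

lemma eq_iff_entries {g h : SL2 F} : g = h ↔ g 0 0 = h 0 0 ∧ g 0 1 = h 0 1 ∧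
    g 1 0 = h 1 0 ∧ g 1 1 = h 1 1 :=
  ⟨fun e ↦ by simp [e], fun ⟨a, b, c, d⟩ ↦ ext_entries a b c d⟩

lemma tr_mul_comm (g h : SL2 F) : tr (g * h) = tr (h * g) := by
  simp only [tr, mul_entry]; ring

lemma tr_conj (g h : SL2 F) : tr (g * h * g⁻¹) = tr h := by
  rw [tr_mul_comm]; simp

lemma commute_iff {g h : SL2 F} : Commute g h ↔
    g 0 1 * h 1 0 = h 0 1 * g 1 0 ∧ g 0 1 * (h 0 0 - h 1 1) = h 0 1 * (g 0 0 - g 1 1) ∧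
      g 1 0 * (h 0 0 - h 1 1) = h 1 0 * (g 0 0 - g 1 1) := by
  rw [commute_iff_eq, eq_iff_entries]
  simp only [mul_entry]
  constructor
  · rintro ⟨h1, h2, h3, h4⟩
    refine ⟨?_, ?_, ?_⟩ <;> grind
  · rintro ⟨h1, h2, h3⟩
    refine ⟨?_, ?_, ?_, ?_⟩ <;> grind

lemma commute_trans {a b c : SL2 F} (hb : ¬ IsScalar b) (hab : Commute a b)
    (hbc : Commute b c) : Commute a c := by
  rw [commute_iff] at *
  simp only [IsScalar, not_and_or] at hb
  rcases hb with hb | hb | hb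
  · refine ⟨?_, ?_, ?_⟩ <;> apply mul_left_cancel₀ hb <;> grind
  · refine ⟨?_, ?_, ?_⟩ <;> apply mul_left_cancel₀ hb <;> grind
  · have hb' := sub_ne_zero.2 hb
    refine ⟨?_, ?_, ?_⟩ <;> apply mul_left_cancel₀ hb' <;> grind

lemma eq_one_or_eq_neg_one_of_isScalar {g : SL2 F} (hg : IsScalar g) : g = 1 ∨ g = -1 := by
  obtain ⟨h1, h2, h3⟩ := hg
  have hd := det_eq g
  have : (g 0 0 - 1) * (g 0 0 + 1) = 0 := by grind
  rcases mul_eq_zero.1 this with h | h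
  · left; apply ext_entries <;> simp <;> grind
  · right; apply ext_entries <;> simp <;> grind

lemma isScalar_conj {g x : SL2 F} (hg : IsScalar g) : IsScalar (x * g * x⁻¹) := by
  have : x * g * x⁻¹ = g := by
    rcases eq_one_or_eq_neg_one_of_isScalar hg with rfl | rfl <;> simp
  rwa [this]

lemma isScalar_conj_iff {g x : SL2 F} : IsScalar (x * g * x⁻¹) ↔ IsScalar g := by
  refine ⟨fun h ↦ ?_, isScalar_conj⟩
  have := isScalar_conj (x := x⁻¹) h
  simpa [mul_assoc] using this

lemma not_isScalar_of_tr {g : SL2 F} (h : tr g ≠ 2) (h' : tr g ≠ -2) : ¬ IsScalar g := by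
  intro hs
  rcases eq_one_or_eq_neg_one_of_isScalar hs with rfl | rfl
  · apply h; simp [tr]; norm_num
  · apply h'; simp [tr]; norm_num

lemma eq_or_eq_inv_of_commute {h k l : SL2 F} (h2 : (2 : F) ≠ 0) (hh : tr h ≠ 2)
    (hh' : tr h ≠ -2) (hk : Commute k h) (hl : Commute l h) (e : tr l = tr k) :
    l = k ∨ l = k⁻¹ := by
  have hd := det_eq h
  have hdk := det_eq k
  have hdl := det_eq l
  rw [commute_iff] at hk hl
  obtain ⟨i1, i2, i3, i4⟩ := inv_entries k
  have hs := not_isScalar_of_tr hh hh'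
  have hdisc : (tr h - 2) * (tr h + 2) ≠ 0 :=
    mul_ne_zero (sub_ne_zero.2 hh) (by rwa [← sub_neg_eq_add, sub_ne_zero])
  simp only [tr] at *
  obtain ⟨s, hs0, hs1, hs2⟩ : ∃ s, k 0 1 = s * h 0 1 ∧ k 1 0 = s * h 1 0 ∧
      k 0 0 - k 1 1 = s * (h 0 0 - h 1 1) := by
    simp only [IsScalar, not_and_or] at hs
    rcases hs with hb | hb | hb
    · refine ⟨k 0 1 / h 0 1, ?_, ?_, ?_⟩ <;> field_simp <;> grind
    · refine ⟨k 1 0 / h 1 0, ?_, ?_, ?_⟩ <;> field_simp <;> grind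
    · have hb' := sub_ne_zero.2 hb
      refine ⟨(k 0 0 - k 1 1) / (h 0 0 - h 1 1), ?_, ?_, ?_⟩ <;> field_simp <;> grind
  obtain ⟨t, ht0, ht1, ht2⟩ : ∃ s, l 0 1 = s * h 0 1 ∧ l 1 0 = s * h 1 0 ∧
      l 0 0 - l 1 1 = s * (h 0 0 - h 1 1) := by
    simp only [IsScalar, not_and_or] at hs
    rcases hs with hb | hb | hb
    · refine ⟨l 0 1 / h 0 1, ?_, ?_, ?_⟩ <;> field_simp <;> grind
    · refine ⟨l 1 0 / h 1 0, ?_, ?_, ?_⟩ <;> field_simp <;> grind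
    · have hb' := sub_ne_zero.2 hb
      refine ⟨(l 0 0 - l 1 1) / (h 0 0 - h 1 1), ?_, ?_, ?_⟩ <;> field_simp <;> grind
  have hst : (s - t) * (s + t) = 0 := by
    apply mul_left_cancel₀ hdisc
    have e1 : (k 0 0 + k 1 1) ^ 2 - 4 = s ^ 2 * ((h 0 0 - h 1 1) ^ 2 + 4 * h 0 1 * h 1 0) := by
      linear_combination (k 0 0 - k 1 1 + s * (h 0 0 - h 1 1)) * hs2 - 4 * (- hdk)
        + 4 * k 1 0 * hs0 + 4 * s * h 0 1 * hs1
    have e2 : (l 0 0 + l 1 1) ^ 2 - 4 = t ^ 2 * ((h 0 0 - h 1 1) ^ 2 + 4 * h 0 1 * h 1 0) := by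
      linear_combination (l 0 0 - l 1 1 + t * (h 0 0 - h 1 1)) * ht2 - 4 * (- hdl)
        + 4 * l 1 0 * ht0 + 4 * t * h 0 1 * ht1
    linear_combination -e1 + e2 - (k 0 0 + k 1 1 + l 0 0 + l 1 1) * e + 4 * (s ^ 2 - t ^ 2) * hd
  rcases mul_eq_zero.1 hst with hst | hst
  · left
    obtain rfl : s = t := sub_eq_zero.1 hst
    apply ext_entries
    · apply mul_left_cancel₀ h2; linear_combination e + ht2 - hs2
    · rw [ht0, hs0]
    · rw [ht1, hs1]
    · apply mul_left_cancel₀ h2; linear_combination e - ht2 + hs2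
  · right
    obtain rfl : t = -s := by grind
    apply ext_entries
    · rw [i1]; apply mul_left_cancel₀ h2; linear_combination e + ht2 + hs2
    · rw [i2, ht0, hs0]; ring
    · rw [i3, ht1, hs1]; ring
    · rw [i4]; apply mul_left_cancel₀ h2; linear_combination e - ht2 - hs2

lemma commute_mul_of_tr_eq_zero {x y z : SL2 F} (hx : tr x = 0) (hy : tr y = 0) (hz : tr z = 0)
    (hxz : tr (x * z) = 0) (hyz : tr (y * z) = 0) : Commute z (x * y) := by
  have key : ∀ {a b : SL2 F}, tr a = 0 → tr b = 0 → tr (a * b) = 0 → a * b = - (b * a) := by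
    intro a b ha hb hab
    simp only [tr, mul_entry] at ha hb hab
    apply ext_entries <;> simp only [Matrix.SpecialLinearGroup.coe_neg, Matrix.neg_apply] <;>
      rw [mul_entry, mul_entry] <;> grind
  rw [commute_iff_eq, mul_assoc x y z, key hy hz hyz, mul_neg, ← mul_assoc x z y, key hx hz hxz,
    neg_mul, neg_neg, mul_assoc]

end Algebra

end SLTwo

namespace SLTwo

section Borel

variable {F : Type*} [Field F]

/-- The stabilizer in `SL₂` of the line spanned by `w`. -/
def borel (w : Fin 2 → F) : Subgroup (SL2 F) where
  carrier := {g | ∃ c : Fˣ, g.1.mulVec w = c • w}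
  one_mem' := ⟨1, by simp⟩
  mul_mem' := by
    rintro g h ⟨c, hc⟩ ⟨d, hd⟩
    refine ⟨d * c, ?_⟩
    rw [Matrix.SpecialLinearGroup.coe_mul, ← Matrix.mulVec_mulVec, hd, Matrix.mulVec_smul, hc,
      mul_smul]
  inv_mem' := by
    rintro g ⟨c, hc⟩
    refine ⟨c⁻¹, ?_⟩
    have h1 : (g⁻¹ * g).1.mulVec w = w := by simp
    rw [Matrix.SpecialLinearGroup.coe_mul, ← Matrix.mulVec_mulVec, hc, Matrix.mulVec_smul] at h1
    rw [eq_inv_smul_iff, h1]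

/-- The stabilizer in `SL₂` of the vector `w`. -/
def unip (w : Fin 2 → F) : Subgroup (SL2 F) where
  carrier := {g | g.1.mulVec w = w}
  one_mem' := Matrix.one_mulVec w
  mul_mem' := by
    intro g h hc hd
    simp only [Set.mem_ofPred_eq] at *
    rw [Matrix.SpecialLinearGroup.coe_mul, ← Matrix.mulVec_mulVec, hd, hc]
  inv_mem' := by
    intro g hc
    simp only [Set.mem_ofPred_eq] at *
    have h1 : (g⁻¹ * g).1.mulVec w = w := by simp
    rwa [Matrix.SpecialLinearGroup.coe_mul, ← Matrix.mulVec_mulVec, hc] at h1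

lemma mem_unip_iff {w : Fin 2 → F} {g : SL2 F} : g ∈ unip w ↔
    g 0 0 * w 0 + g 0 1 * w 1 = w 0 ∧ g 1 0 * w 0 + g 1 1 * w 1 = w 1 := by
  change g.1.mulVec w = w ↔ _
  rw [funext_iff]
  simp [Fin.forall_fin_two, Matrix.mulVec, dotProduct, Fin.sum_univ_two]

lemma vec_ne_zero {w : Fin 2 → F} (hw : w ≠ 0) : w 0 ≠ 0 ∨ w 1 ≠ 0 := by
  by_contra! h
  exact hw (by ext i; fin_cases i; exacts [h.1, h.2])

lemma exists_eigenvalue {w : Fin 2 → F} {g : SL2 F} (hg : g ∈ borel w) :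
    ∃ c : F, c ≠ 0 ∧ g 0 0 * w 0 + g 0 1 * w 1 = c * w 0 ∧ g 1 0 * w 0 + g 1 1 * w 1 = c * w 1 := by
  obtain ⟨c, hc⟩ := hg
  refine ⟨c, c.ne_zero, ?_⟩
  rw [funext_iff] at hc
  simpa [Fin.forall_fin_two, Matrix.mulVec, dotProduct, Fin.sum_univ_two, Units.smul_def] using hc

lemma mem_borel_of_eigenvalue {w : Fin 2 → F} {g : SL2 F} {c : F} (hc : c ≠ 0)
    (h0 : g 0 0 * w 0 + g 0 1 * w 1 = c * w 0) (h1 : g 1 0 * w 0 + g 1 1 * w 1 = c * w 1) :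
    g ∈ borel w := by
  refine ⟨Units.mk0 c hc, ?_⟩
  rw [funext_iff]
  simpa [Fin.forall_fin_two, Matrix.mulVec, dotProduct, Fin.sum_univ_two, Units.smul_def] using
    ⟨h0, h1⟩

lemma mem_borel_iff {w : Fin 2 → F} (hw : w ≠ 0) {g : SL2 F} : g ∈ borel w ↔
    (g 0 0 * w 0 + g 0 1 * w 1) * w 1 = (g 1 0 * w 0 + g 1 1 * w 1) * w 0 := by
  constructor
  · intro h
    obtain ⟨c, -, h0, h1⟩ := exists_eigenvalue h
    rw [h0, h1]; ring
  · intro h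
    have hd := det_eq g
    obtain ⟨c, h0, h1⟩ : ∃ c, g 0 0 * w 0 + g 0 1 * w 1 = c * w 0 ∧
        g 1 0 * w 0 + g 1 1 * w 1 = c * w 1 := by
      rcases vec_ne_zero hw with hw | hw
      · exact ⟨(g 0 0 * w 0 + g 0 1 * w 1) / w 0, by field_simp, by field_simp; linear_combination -h⟩
      · exact ⟨(g 1 0 * w 0 + g 1 1 * w 1) / w 1, by field_simp; linear_combination h, by field_simp⟩
    refine mem_borel_of_eigenvalue ?_ h0 h1
    rintro rfl
    rcases vec_ne_zero hw with hw | hw <;> apply hw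
    · linear_combination -(w 0) * hd + g 1 1 * h0 - g 0 1 * h1
    · linear_combination -(w 1) * hd - g 1 0 * h0 + g 0 0 * h1

lemma borel_eq_of_parallel {w w' : Fin 2 → F} (hw : w ≠ 0) (hw' : w' ≠ 0)
    (h : w 0 * w' 1 = w 1 * w' 0) : borel w = borel w' := by
  have key : ∀ {w w' : Fin 2 → F}, w ≠ 0 → w' ≠ 0 → w 0 * w' 1 = w 1 * w' 0 →
      borel w ≤ borel w' := by
    intro w w' hw hw' h g hg
    rw [mem_borel_iff hw] at hg
    rw [mem_borel_iff hw']
    rcases vec_ne_zero hw with hw | hw <;> apply mul_left_cancel₀ (pow_ne_zero 2 hw) <;> grind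
  exact le_antisymm (key hw hw' h) (key hw' hw (by rw [mul_comm, ← h, mul_comm]))

lemma unip_inf_eq_one {w w' : Fin 2 → F} (h : w 0 * w' 1 ≠ w 1 * w' 0) {g : SL2 F}
    (hg : g ∈ unip w) (hg' : g ∈ unip w') : g = 1 := by
  rw [mem_unip_iff] at hg hg'
  obtain ⟨h1, h2⟩ := hg
  obtain ⟨h3, h4⟩ := hg'
  have h := sub_ne_zero.2 h
  apply ext_entries <;> apply mul_left_cancel₀ h <;> simp <;> grind

lemma inv_mul_mem_unip_or_mul_mem_unip {w : Fin 2 → F} (hw : w ≠ 0) {x y : SL2 F}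
    (hx : x ∈ borel w) (hy : y ∈ borel w) (h : tr y = tr x) : x⁻¹ * y ∈ unip w ∨ x * y ∈ unip w := by
  have eig : ∀ {g : SL2 F} {c : F}, g 0 0 * w 0 + g 0 1 * w 1 = c * w 0 →
      g 1 0 * w 0 + g 1 1 * w 1 = c * w 1 → c ^ 2 - tr g * c + 1 = 0 := by
    intro g c h0 h1
    have hd := det_eq g
    unfold tr
    rcases vec_ne_zero hw with hw | hw <;> apply mul_left_cancel₀ hw
    · linear_combination (g 1 1 - c) * h0 - g 0 1 * h1 - w 0 * hd
    · linear_combination (g 0 0 - c) * h1 - g 1 0 * h0 - w 1 * hd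
  obtain ⟨c, hc, hc0, hc1⟩ := exists_eigenvalue hx
  obtain ⟨d, hd, hd0, hd1⟩ := exists_eigenvalue hy
  have e1 := eig hc0 hc1
  have e2 := eig hd0 hd1
  obtain ⟨i1, i2, i3, i4⟩ := inv_entries x
  have hdx := det_eq x
  have : (c - d) * (c * d - 1) = 0 := by
    rw [h] at e2
    linear_combination d * e1 - c * e2
  rcases mul_eq_zero.1 this with e | e
  · left
    obtain rfl : c = d := sub_eq_zero.1 e
    rw [mem_unip_iff]
    simp only [mul_entry, i1, i2, i3, i4]
    constructor <;> apply mul_left_cancel₀ hc <;> grind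
  · right
    rw [mem_unip_iff]
    simp only [mul_entry]
    constructor <;> grind

lemma isScalar_of_mem_borel {w₁ w₂ w₃ : Fin 2 → F} (h₁ : w₁ ≠ 0) (h₂ : w₂ ≠ 0) (h₃ : w₃ ≠ 0)
    (h₁₂ : w₁ 0 * w₂ 1 ≠ w₁ 1 * w₂ 0) (h₁₃ : w₁ 0 * w₃ 1 ≠ w₁ 1 * w₃ 0)
    (h₂₃ : w₂ 0 * w₃ 1 ≠ w₂ 1 * w₃ 0) {g : SL2 F} (hg₁ : g ∈ borel w₁) (hg₂ : g ∈ borel w₂)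
    (hg₃ : g ∈ borel w₃) : IsScalar g := by
  rw [mem_borel_iff h₁] at hg₁
  rw [mem_borel_iff h₂] at hg₂
  rw [mem_borel_iff h₃] at hg₃
  have hne := mul_ne_zero (mul_ne_zero (sub_ne_zero.2 h₁₂) (sub_ne_zero.2 h₁₃)) (sub_ne_zero.2 h₂₃)
  refine ⟨?_, ?_, sub_eq_zero.1 ?_⟩ <;> apply mul_left_cancel₀ hne
  · linear_combination (w₂ 0 * w₃ 0 * (w₂ 0 * w₃ 1 - w₂ 1 * w₃ 0)) * hg₁ -
      (w₁ 0 * w₃ 0 * (w₁ 0 * w₃ 1 - w₁ 1 * w₃ 0)) * hg₂ +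
      (w₁ 0 * w₂ 0 * (w₁ 0 * w₂ 1 - w₁ 1 * w₂ 0)) * hg₃
  · linear_combination -(w₂ 1 * w₃ 1 * (w₂ 0 * w₃ 1 - w₂ 1 * w₃ 0)) * hg₁ +
      (w₁ 1 * w₃ 1 * (w₁ 0 * w₃ 1 - w₁ 1 * w₃ 0)) * hg₂ -
      (w₁ 1 * w₂ 1 * (w₁ 0 * w₂ 1 - w₁ 1 * w₂ 0)) * hg₃
  · linear_combination
      -((w₂ 0 * w₃ 1 + w₂ 1 * w₃ 0) * (w₂ 0 * w₃ 1 - w₂ 1 * w₃ 0)) * hg₁ +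
      ((w₁ 0 * w₃ 1 + w₁ 1 * w₃ 0) * (w₁ 0 * w₃ 1 - w₁ 1 * w₃ 0)) * hg₂ -
      ((w₁ 0 * w₂ 1 + w₁ 1 * w₂ 0) * (w₁ 0 * w₂ 1 - w₁ 1 * w₂ 0)) * hg₃

lemma exists_two_borels {g : SL2 F} (hg : ¬ IsScalar g) : ∃ w₁ w₂ : Fin 2 → F, w₁ ≠ 0 ∧ w₂ ≠ 0 ∧
    ∀ w, w ≠ 0 → g ∈ borel w → borel w = borel w₁ ∨ borel w = borel w₂ := by
  have hne : (![1, 0] : Fin 2 → F) ≠ 0 := fun h ↦ by simpa using congrFun h 0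
  by_cases h1 : ∃ w, w ≠ 0 ∧ g ∈ borel w
  · obtain ⟨w₁, hw₁, hg₁⟩ := h1
    by_cases h2 : ∃ w, w ≠ 0 ∧ g ∈ borel w ∧ w₁ 0 * w 1 ≠ w₁ 1 * w 0
    · obtain ⟨w₂, hw₂, hg₂, hn⟩ := h2
      refine ⟨w₁, w₂, hw₁, hw₂, fun w hw hgw ↦ ?_⟩
      by_contra! hcon
      refine hg (isScalar_of_mem_borel hw₁ hw₂ hw hn (fun h ↦ ?_) (fun h ↦ ?_) hg₁ hg₂ hgw)
      · exact hcon.1 (borel_eq_of_parallel hw₁ hw h).symm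
      · exact hcon.2 (borel_eq_of_parallel hw₂ hw h).symm
    · push Not at h2
      exact ⟨w₁, w₁, hw₁, hw₁, fun w hw hgw ↦
        .inl (borel_eq_of_parallel hw₁ hw (h2 w hw hgw)).symm⟩
  · push Not at h1
    exact ⟨_, _, hne, hne, fun w hw hgw ↦ (h1 w hw hgw).elim⟩

lemma cross_mulVec_ne_zero {w : Fin 2 → F} (hw : w ≠ 0) {a : SL2 F} (ha : a ∉ borel w) :
    w 0 * a.1.mulVec w 1 ≠ w 1 * a.1.mulVec w 0 := by
  intro h
  refine ha ((mem_borel_iff hw).2 ?_)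
  simp only [Matrix.mulVec, dotProduct, Fin.sum_univ_two] at h
  linear_combination -h

lemma conj_mem_unip {w : Fin 2 → F} {a v : SL2 F} (hv : v ∈ unip w) :
    a * v * a⁻¹ ∈ unip (a.1.mulVec w) := by
  change v.1.mulVec w = w at hv
  change (a * v * a⁻¹).1.mulVec _ = _
  rw [Matrix.mulVec_mulVec, ← Matrix.SpecialLinearGroup.coe_mul, inv_mul_cancel_right,
    Matrix.SpecialLinearGroup.coe_mul, ← Matrix.mulVec_mulVec, hv]

end Borel

section Fiber

variable {F : Type*} [Field F]

lemma exists_smul_eq_of_cross_eq_zero {a b c a' b' c' : F} (h : a ≠ 0 ∨ b ≠ 0 ∨ c ≠ 0)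
    (hab : a * b' = b * a') (hac : a * c' = c * a') (hbc : b * c' = c * b') :
    ∃ s, a' = s * a ∧ b' = s * b ∧ c' = s * c := by
  rcases h with h | h | h
  · exact ⟨a' / a, by field_simp, by field_simp; linear_combination hab,
      by field_simp; linear_combination hac⟩
  · exact ⟨b' / b, by field_simp; linear_combination -hab, by field_simp,
      by field_simp; linear_combination hbc⟩
  · exact ⟨c' / c, by field_simp; linear_combination -hac,
      by field_simp; linear_combination -hbc, by field_simp⟩

lemma exists_borel_of_tr_inv_mul_eq_two {x x' : SL2 F} (hne : x ≠ x') (ht : tr x' = tr x)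
    (hq : tr (x⁻¹ * x') = 2) : ∃ w : Fin 2 → F, w ≠ 0 ∧ x ∈ borel w ∧ x' ∈ borel w ∧
      ∀ y, tr (x' * y) = tr (x * y) → y ∈ borel w := by
  obtain ⟨i1, i2, i3, i4⟩ := inv_entries x
  have hdx := det_eq x
  have hdx' := det_eq x'
  simp only [tr, mul_entry, i1, i2, i3, i4] at ht hq ⊢
  obtain ⟨D, hD⟩ : ∃ D : Fin 2 → Fin 2 → F, ∀ i j, x' i j = x i j + D i j :=
    ⟨fun i j ↦ x' i j - x i j, fun i j ↦ by ring⟩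
  rw [hD, hD] at ht
  rw [hD, hD, hD, hD] at hdx' hq
  have ht' : D 1 1 = - D 0 0 := by linear_combination ht
  have hdet : D 0 0 * D 0 0 + D 0 1 * D 1 0 = 0 := by
    linear_combination -hdx' - hdx + hq + (D 0 0) * ht'
  have hxD : x 0 0 * D 0 0 + x 0 1 * D 1 0 + x 1 0 * D 0 1 + x 1 1 * D 1 1 = 0 := by
    linear_combination -hq + 2 * hdx + (x 0 0 + x 1 1) * ht'
  have hcase : D 0 1 ≠ 0 ∨ D 1 0 ≠ 0 := by
    by_contra! hcon
    obtain ⟨e1, e2⟩ := hcon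
    apply hne
    have e3 : D 0 0 = 0 := by rw [e1] at hdet; simpa using hdet
    apply ext_entries <;> rw [hD]
    · rw [e3, add_zero]
    · rw [e1, add_zero]
    · rw [e2, add_zero]
    · rw [ht', e3, neg_zero, add_zero]
  obtain ⟨w, hw, key⟩ : ∃ w : Fin 2 → F, w ≠ 0 ∧ ∀ y : SL2 F,
      y 0 0 * D 0 0 + y 0 1 * D 1 0 + y 1 0 * D 0 1 + y 1 1 * D 1 1 = 0 → y ∈ borel w := by
    rcases hcase with h | h
    · have hw : ![D 0 1, D 1 1] ≠ 0 := fun e ↦ h (by simpa using congrFun e 0)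
      refine ⟨_, hw, fun y hy ↦ ?_⟩
      rw [mem_borel_iff hw]
      simp only [Matrix.cons_val_zero, Matrix.cons_val_one]
      rw [ht'] at hy ⊢
      linear_combination (-D 0 1) * hy + y 0 1 * hdet
    · have hw : ![D 0 0, D 1 0] ≠ 0 := fun e ↦ h (by simpa using congrFun e 1)
      refine ⟨_, hw, fun y hy ↦ ?_⟩
      rw [mem_borel_iff hw]
      simp only [Matrix.cons_val_zero, Matrix.cons_val_one]
      rw [ht'] at hy
      linear_combination (D 1 0) * hy - y 1 0 * hdet
  refine ⟨w, hw, key x hxD, key x' ?_, fun y hy ↦ key y ?_⟩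
  · rw [hD, hD, hD, hD, ht'] at *
    linear_combination hxD + 2 * hdet
  · rw [hD, hD, hD, hD] at hy
    linear_combination hy

lemma tr_inv_mul_eq_two_of_collinear {x x' x'' : SL2 F} {s : F} (hs0 : s ≠ 0) (hs1 : s ≠ 1)
    (h : ∀ i j, x'' i j - x i j = s * (x' i j - x i j)) : tr (x⁻¹ * x') = 2 := by
  obtain ⟨i1, i2, i3, i4⟩ := inv_entries x
  have hdx := det_eq x
  have hdx' := det_eq x'
  have hdx'' := det_eq x''
  simp only [tr, mul_entry, i1, i2, i3, i4]
  have h00 := eq_add_of_sub_eq (h 0 0)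
  have h01 := eq_add_of_sub_eq (h 0 1)
  have h10 := eq_add_of_sub_eq (h 1 0)
  have h11 := eq_add_of_sub_eq (h 1 1)
  rw [h00, h01, h10, h11] at hdx''
  apply mul_left_cancel₀ (mul_ne_zero hs0 (sub_ne_zero.2 hs1))
  linear_combination - hdx'' + s ^ 2 * hdx' + (s-1)^2 * hdx

end Fiber

end SLTwo

namespace SLTwo

section FiberBound

variable {F : Type*} [Field F]

lemma exists_affine_of_commute {y z : SL2 F} (hy : ¬ IsScalar y) (h : Commute y z) :
    ∃ a b : F, z 0 0 = a + b * y 0 0 ∧ z 0 1 = b * y 0 1 ∧ z 1 0 = b * y 1 0 ∧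
      z 1 1 = a + b * y 1 1 := by
  obtain ⟨h1, h2, h3⟩ := commute_iff.1 h
  have hne : y 0 1 ≠ 0 ∨ y 1 0 ≠ 0 ∨ y 0 0 - y 1 1 ≠ 0 := by
    by_contra! hcon
    exact hy ⟨hcon.1, hcon.2.1, sub_eq_zero.1 hcon.2.2⟩
  obtain ⟨s, hs1, hs2, hs3⟩ := exists_smul_eq_of_cross_eq_zero hne
    (a' := z 0 1) (b' := z 1 0) (c' := z 0 0 - z 1 1)
    (by linear_combination h1) (by linear_combination h2) (by linear_combination h3)
  exact ⟨z 0 0 - s * y 0 0, s, by ring, hs1, hs2, by linear_combination -hs3⟩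

lemma exists_borel_of_collinear {x y z : SL2 F} {s : F} (hxy : x ≠ y) (hs0 : s ≠ 0) (hs1 : s ≠ 1)
    (ht : tr y = tr x) (h : ∀ i j, z i j - x i j = s * (y i j - x i j)) :
    ∃ w : Fin 2 → F, w ≠ 0 ∧ x ∈ borel w ∧ y ∈ borel w ∧ z ∈ borel w := by
  obtain ⟨w, hw, hx, hy, -⟩ := exists_borel_of_tr_inv_mul_eq_two hxy ht
    (tr_inv_mul_eq_two_of_collinear hs0 hs1 h)
  refine ⟨w, hw, hx, hy, ?_⟩
  rw [mem_borel_iff hw] at *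
  rw [eq_add_of_sub_eq (h 0 0), eq_add_of_sub_eq (h 0 1), eq_add_of_sub_eq (h 1 0),
    eq_add_of_sub_eq (h 1 1)]
  linear_combination (1 - s) * hx + s * hy

/-- Solutions `x` of `tr x = tr (x y) = tr (x z) = t` are unique up to two choices unless
`x`, `x y`, `x z` stabilize a common line. -/
lemma exists_borel_of_three_solutions {t : F} (h2 : (2 : F) ≠ 0) (ht : t ≠ 0) {x x' x'' y z : SL2 F}
    (hx : tr x = t) (hx' : tr x' = t) (hx'' : tr x'' = t)
    (hxy : tr (x * y) = t) (hxy' : tr (x' * y) = t) (hxy'' : tr (x'' * y) = t)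
    (hxz : tr (x * z) = t) (hxz' : tr (x' * z) = t) (hxz'' : tr (x'' * z) = t)
    (h₁ : x ≠ x') (h₂ : x ≠ x'') (h₃ : x' ≠ x'') (hy : y ≠ 1) (hz : z ≠ 1) (hyz : y ≠ z) :
    ∃ w : Fin 2 → F, w ≠ 0 ∧ x ∈ borel w ∧ x * y ∈ borel w ∧ x * z ∈ borel w := by
  by_cases hc : Commute y z
  · have hys : ¬ IsScalar y := by
      intro hs
      rcases eq_one_or_eq_neg_one_of_isScalar hs with rfl | rfl
      · exact hy rfl
      · refine mul_ne_zero h2 ht ?_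
        simp only [tr, mul_neg, mul_one, Matrix.SpecialLinearGroup.coe_neg, Matrix.neg_apply]
          at hxy hx
        linear_combination -hxy - hx
    obtain ⟨a, b, e00, e01, e10, e11⟩ := exists_affine_of_commute hys hc
    have hab : a + b = 1 := by
      apply mul_right_cancel₀ ht
      simp only [tr, mul_entry, e00, e01, e10, e11] at hx hxy hxz
      linear_combination hxz - b * hxy - a * hx
    obtain rfl : a = 1 - b := eq_sub_of_add_eq hab
    refine exists_borel_of_collinear (s := b) (x := x) (y := x * y) (z := x * z) ?_ ?_ ?_
      (hxy.trans hx.symm) ?_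
    · simpa [eq_comm] using hy
    · rintro rfl
      exact hz (ext_entries (by simpa using e00) (by simpa using e01) (by simpa using e10)
        (by simpa using e11))
    · rintro rfl
      exact hyz (ext_entries (by simpa using e00.symm) (by simpa using e01.symm)
        (by simpa using e10.symm) (by simpa using e11.symm))
    · intro i j
      fin_cases j <;> simp [mul_entry, e00, e01, e10, e11] <;> ring
  · have hn : y 0 1 * z 1 0 - z 0 1 * y 1 0 ≠ 0 ∨
        z 0 1 * (y 0 0 - y 1 1) - y 0 1 * (z 0 0 - z 1 1) ≠ 0 ∨
        y 1 0 * (z 0 0 - z 1 1) - z 1 0 * (y 0 0 - y 1 1) ≠ 0 := by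
      by_contra! hcon
      obtain ⟨c1, c2, c3⟩ := hcon
      exact hc (commute_iff.2 ⟨by linear_combination c1, by linear_combination -c2,
        by linear_combination c3⟩)
    have key : ∀ {x' : SL2 F}, tr x' = t → tr (x' * y) = t → tr (x' * z) = t → x ≠ x' →
        ∃ s : F, s ≠ 0 ∧
          x' 0 0 - x 0 0 = s * (y 0 1 * z 1 0 - z 0 1 * y 1 0) ∧
          x' 1 0 - x 1 0 = s * (y 1 0 * (z 0 0 - z 1 1) - z 1 0 * (y 0 0 - y 1 1)) ∧
          x' 0 1 - x 0 1 = s * (z 0 1 * (y 0 0 - y 1 1) - y 0 1 * (z 0 0 - z 1 1)) ∧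
          x' 1 1 - x 1 1 = -s * (y 0 1 * z 1 0 - z 0 1 * y 1 0) := by
      intro x' hx' hxy' hxz' hne
      simp only [tr, mul_entry] at hx hxy hxz hx' hxy' hxz'
      have ey : (x' 0 0 - x 0 0) * (y 0 0 - y 1 1) + (x' 0 1 - x 0 1) * y 1 0 +
          (x' 1 0 - x 1 0) * y 0 1 = 0 := by
        linear_combination hxy' - hxy - y 1 1 * (hx' - hx)
      have ez : (x' 0 0 - x 0 0) * (z 0 0 - z 1 1) + (x' 0 1 - x 0 1) * z 1 0 +
          (x' 1 0 - x 1 0) * z 0 1 = 0 := by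
        linear_combination hxz' - hxz - z 1 1 * (hx' - hx)
      obtain ⟨s, s0, s1, s2⟩ := exists_smul_eq_of_cross_eq_zero hn
        (a' := x' 0 0 - x 0 0) (b' := x' 0 1 - x 0 1) (c' := x' 1 0 - x 1 0)
        (by linear_combination y 0 1 * ez - z 0 1 * ey)
        (by linear_combination z 1 0 * ey - y 1 0 * ez)
        (by linear_combination (y 0 0 - y 1 1) * ez - (z 0 0 - z 1 1) * ey)
      refine ⟨s, ?_, s0, s2, s1,
        by linear_combination hx' - hx - s0⟩
      rintro rfl
      exact hne (ext_entries (by linear_combination -s0) (by linear_combination -s1)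
        (by linear_combination -s2) (by linear_combination hx - hx' + s0))
    obtain ⟨s, hs, s00, s10, s01, s11⟩ := key hx' hxy' hxz' h₁
    obtain ⟨r, hr, r00, r10, r01, r11⟩ := key hx'' hxy'' hxz'' h₂
    have hq : tr (x⁻¹ * x') = 2 := by
      refine tr_inv_mul_eq_two_of_collinear (x'' := x'') (s := r / s) (div_ne_zero hr hs) ?_ ?_
      · intro e
        obtain rfl : r = s := by field_simp at e; exact e
        exact h₃ (ext_entries (by linear_combination s00 - r00) (by linear_combination s01 - r01)
          (by linear_combination s10 - r10) (by linear_combination s11 - r11))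
      · intro i j
        fin_cases i <;> fin_cases j <;> simp [*] <;> field_simp
    obtain ⟨w, hw, hxw, -, hk⟩ := exists_borel_of_tr_inv_mul_eq_two h₁ (hx'.trans hx.symm) hq
    exact ⟨w, hw, hxw, mul_mem hxw (hk y (hxy'.trans hxy.symm)),
      mul_mem hxw (hk z (hxz'.trans hxz.symm))⟩

end FiberBound

end SLTwo

namespace SLTwo

open Finset

open scoped Classical

section TraceCount

variable {F : Type*} [Field F]

lemma card_filter_unip_sq_le {S T : Finset (SL2 F)} {w : Fin 2 → F} (hw : w ≠ 0) {a : SL2 F}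
    (ha : a ∉ borel w) (hT : ∀ u ∈ S, ∀ v ∈ S, u * (a * v * a⁻¹) ∈ T) :
    #{y ∈ S | y ∈ unip w} ^ 2 ≤ #T := by
  rw [sq, ← card_product]
  refine card_le_card_of_injOn (fun q ↦ q.1 * (a * q.2 * a⁻¹)) ?_ ?_
  · rintro ⟨u, v⟩ h
    simp only [coe_product, coe_filter, Set.mem_prod, Set.mem_ofPred_eq] at h
    exact hT _ h.1.1 _ h.2.1
  · rintro ⟨u, v⟩ h ⟨u', v'⟩ h' e
    simp only [coe_product, coe_filter, Set.mem_prod, Set.mem_ofPred_eq] at h h' e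
    have key : u'⁻¹ * u = a * (v' * v⁻¹) * a⁻¹ := by
      rw [inv_mul_eq_iff_eq_mul, ← mul_inv_eq_iff_eq_mul.2 e.symm]
      group
    have h1 : u'⁻¹ * u = 1 := by
      refine unip_inf_eq_one (cross_mulVec_ne_zero hw ha) (mul_mem (inv_mem h'.1.2) h.1.2) ?_
      rw [key]
      exact conj_mem_unip (mul_mem h'.2.2 (inv_mem h.2.2))
    rw [h1] at key
    have h2 := conj_eq_one_iff.1 key.symm
    rw [Prod.mk.injEq]
    exact ⟨(inv_mul_eq_one.1 h1).symm, (mul_inv_eq_one.1 h2).symm⟩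

variable [DecidableEq F]

lemma card_bad_pairs_le {W : Finset (SL2 F)} {β : ℕ} {x : SL2 F} (hx : ¬ IsScalar x)
    (hβ : ∀ w : Fin 2 → F, w ≠ 0 → #{y ∈ W | y ∈ borel w} ≤ β) :
    #{q ∈ W ×ˢ W | x = q.1 ∨ x = q.2 ∨ q.1 = q.2 ∨
      ∃ w : Fin 2 → F, w ≠ 0 ∧ x ∈ borel w ∧ q.1 ∈ borel w ∧ q.2 ∈ borel w} ≤
      3 * #W + 2 * β ^ 2 := by
  obtain ⟨w₁, w₂, h₁, h₂, hw⟩ := exists_two_borels hx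
  have hsub : {q ∈ W ×ˢ W | x = q.1 ∨ x = q.2 ∨ q.1 = q.2 ∨
      ∃ w : Fin 2 → F, w ≠ 0 ∧ x ∈ borel w ∧ q.1 ∈ borel w ∧ q.2 ∈ borel w} ⊆
      W.image (fun y ↦ (x, y)) ∪ (W.image (fun y ↦ (y, x)) ∪ (W.image (fun y ↦ (y, y)) ∪
        ({y ∈ W | y ∈ borel w₁} ×ˢ {y ∈ W | y ∈ borel w₁} ∪
          {y ∈ W | y ∈ borel w₂} ×ˢ {y ∈ W | y ∈ borel w₂}))) := by
    rintro ⟨y, z⟩ h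
    simp only [mem_filter, mem_product] at h
    simp only [mem_union, mem_image, mem_product, mem_filter, Prod.mk.injEq]
    obtain ⟨⟨hy, hz⟩, rfl | rfl | rfl | ⟨w, hw0, hxw, hyw, hzw⟩⟩ := h
    · exact .inl ⟨z, hz, rfl, rfl⟩
    · exact .inr (.inl ⟨y, hy, rfl, rfl⟩)
    · exact .inr (.inr (.inl ⟨y, hy, rfl, rfl⟩))
    · rcases hw w hw0 hxw with e | e <;> rw [e] at hyw hzw
      · exact .inr (.inr (.inr (.inl ⟨⟨hy, hyw⟩, hz, hzw⟩)))
      · exact .inr (.inr (.inr (.inr ⟨⟨hy, hyw⟩, hz, hzw⟩)))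
  refine (card_le_card hsub).trans ?_
  have e₁ := hβ w₁ h₁
  have e₂ := hβ w₂ h₂
  have f₁ := Nat.mul_le_mul e₁ e₁
  have f₂ := Nat.mul_le_mul e₂ e₂
  rw [← card_product] at f₁ f₂
  have g₁ := card_image_le (s := W) (f := fun y ↦ (x, y))
  have g₂ := card_image_le (s := W) (f := fun y ↦ (y, x))
  have g₃ := card_image_le (s := W) (f := fun y ↦ (y, y))
  refine (card_union_le _ _).trans ((Nat.add_le_add_left ((card_union_le _ _).trans
    (Nat.add_le_add_left ((card_union_le _ _).trans (Nat.add_le_add_left (card_union_le _ _) _))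
      _)) _).trans ?_)
  nlinarith

/-- The Larsen–Pink type bound for a set of elements of given nonzero trace. -/
lemma card_pow_three_le {W S : Finset (SL2 F)} {β : ℕ} {t : F} (h2 : (2 : F) ≠ 0) (ht : t ≠ 0)
    (hW : ∀ x ∈ W, ¬ IsScalar x ∧ tr x = t) (hS : ∀ x ∈ W, ∀ y ∈ W, x⁻¹ * y ∈ S)
    (hβ : ∀ w : Fin 2 → F, w ≠ 0 → #{y ∈ W | y ∈ borel w} ≤ β) :
    #W ^ 3 ≤ 2 * #S ^ 2 + 3 * #W ^ 2 + 2 * β ^ 2 * #W := by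
  set bad : SL2 F → SL2 F × SL2 F → Prop := fun x q ↦ x = q.1 ∨ x = q.2 ∨ q.1 = q.2 ∨
      ∃ w : Fin 2 → F, w ≠ 0 ∧ x ∈ borel w ∧ q.1 ∈ borel w ∧ q.2 ∈ borel w with hbad
  have hgood : #{q ∈ W ×ˢ (W ×ˢ W) | ¬ bad q.1 q.2} ≤ 2 * #(S ×ˢ S) := by
    refine card_le_mul_card_image_of_maps_to
      (f := fun q ↦ (q.1⁻¹ * q.2.1, q.1⁻¹ * q.2.2)) ?_ 2 ?_
    · rintro ⟨x, y, z⟩ h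
      simp only [mem_filter, mem_product] at h
      exact mem_product.2 ⟨hS _ h.1.1 _ h.1.2.1, hS _ h.1.1 _ h.1.2.2⟩
    · rintro ⟨y, z⟩ -
      by_contra! hcon
      obtain ⟨⟨x₁, y₁, z₁⟩, m₁, ⟨x₂, y₂, z₂⟩, m₂, ⟨x₃, y₃, z₃⟩, m₃, n₁₂, n₁₃, n₂₃⟩ :=
        two_lt_card.1 hcon
      simp only [mem_filter, mem_product, Prod.mk.injEq, inv_mul_eq_iff_eq_mul] at m₁ m₂ m₃
      obtain ⟨⟨⟨hx₁, hy₁, hz₁⟩, hb⟩, rfl, rfl⟩ := m₁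
      obtain ⟨⟨⟨hx₂, hy₂, hz₂⟩, -⟩, rfl, rfl⟩ := m₂
      obtain ⟨⟨⟨hx₃, hy₃, hz₃⟩, -⟩, rfl, rfl⟩ := m₃
      simp only [hbad, not_or] at hb
      obtain ⟨b₁, b₂, b₃, b₄⟩ := hb
      refine b₄ (exists_borel_of_three_solutions h2 ht (hW _ hx₁).2 (hW _ hx₂).2 (hW _ hx₃).2
        (hW _ hy₁).2 (hW _ hy₂).2 (hW _ hy₃).2 (hW _ hz₁).2 (hW _ hz₂).2 (hW _ hz₃).2
        ?_ ?_ ?_ ?_ ?_ ?_)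
      · rintro rfl; exact n₁₂ rfl
      · rintro rfl; exact n₁₃ rfl
      · rintro rfl; exact n₂₃ rfl
      · rintro rfl; simp at b₁
      · rintro rfl; simp at b₂
      · rintro rfl; simp at b₃
  have hbadcard : #{q ∈ W ×ˢ (W ×ˢ W) | bad q.1 q.2} ≤ (3 * #W + 2 * β ^ 2) * #W := by
    refine card_le_mul_card_image_of_maps_to (f := fun q ↦ q.1) (fun q hq ↦ ?_) _ ?_
    · exact (mem_product.1 (mem_filter.1 hq).1).1
    · intro x hx
      refine le_trans ?_ (card_bad_pairs_le (hW x hx).1 hβ)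
      refine card_le_card_of_injOn (fun q ↦ q.2) ?_ ?_
      · rintro ⟨x', q⟩ h
        simp only [coe_filter, mem_filter, mem_product, Set.mem_ofPred_eq] at h ⊢
        obtain ⟨⟨⟨-, h1⟩, h2⟩, rfl⟩ := h
        exact ⟨h1, h2⟩
      · rintro ⟨x', q⟩ h ⟨x'', q'⟩ h' e
        simp only [coe_filter, Set.mem_ofPred_eq] at h h' e
        rw [h.2, h'.2, e]
  have htot := card_filter_add_card_filter_not (s := W ×ˢ (W ×ˢ W)) (fun q ↦ bad q.1 q.2)
  rw [card_product, card_product] at htot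
  rw [card_product] at hgood
  nlinarith

lemma card_filter_borel_le {W S : Finset (SL2 F)} {t : F} (hW : ∀ x ∈ W, tr x = t)
    (hS : ∀ x ∈ W, ∀ y ∈ W, x⁻¹ * y ∈ S ∧ x * y ∈ S) {w : Fin 2 → F} (hw : w ≠ 0) :
    #{y ∈ W | y ∈ borel w} ≤ 2 * #{y ∈ S | y ∈ unip w} := by
  rcases ({y ∈ W | y ∈ borel w}).eq_empty_or_nonempty with h | ⟨x, hx⟩
  · rw [h]; simp
  rw [mem_filter] at hx
  have hsub : {y ∈ W | y ∈ borel w} ⊆ {y ∈ S | y ∈ unip w}.image (fun u ↦ x * u) ∪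
      {y ∈ S | y ∈ unip w}.image (fun u ↦ x⁻¹ * u) := by
    intro y hy
    rw [mem_filter] at hy
    rw [mem_union, mem_image, mem_image]
    rcases inv_mul_mem_unip_or_mul_mem_unip hw hx.2 hy.2 ((hW y hy.1).trans (hW x hx.1).symm)
      with h | h
    · exact .inl ⟨_, mem_filter.2 ⟨(hS x hx.1 y hy.1).1, h⟩, by simp⟩
    · exact .inr ⟨_, mem_filter.2 ⟨(hS x hx.1 y hy.1).2, h⟩, by simp⟩
  rw [two_mul]
  exact (card_le_card hsub).trans ((card_union_le _ _).trans
    (add_le_add card_image_le card_image_le))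

end TraceCount

end SLTwo

namespace SLTwo

open Finset

open scoped Classical

section Growth

variable {F : Type*} [Field F] [DecidableEq F]

/-- A symmetric generating-type set of `SL₂` whose powers grow slowly: it contains `1`, it is
contained in no Borel subgroup, and `|A ^ m| ≤ L ^ (m - 2) |A|`. -/
structure IsSlow (A : Finset (SL2 F)) (L : ℕ) : Prop where
  two_le : 2 ≤ L
  one_mem : 1 ∈ A
  inv_eq : A⁻¹ = A
  card_pow_le : ∀ m, 3 ≤ m → #(A ^ m) ≤ L ^ (m - 2) * #A
  exists_notMem_borel : ∀ w : Fin 2 → F, w ≠ 0 → ∃ a ∈ A, a ∉ borel w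

variable {A : Finset (SL2 F)} {L : ℕ}

lemma mul_mem_pow_add {x y : SL2 F} {m n k : ℕ} (hx : x ∈ A ^ m) (hy : y ∈ A ^ n)
    (h : m + n = k) : x * y ∈ A ^ k := by
  rw [← h, pow_add]; exact mul_mem_mul hx hy

namespace IsSlow

lemma inv_mem_pow (hA : IsSlow A L) {x : SL2 F} {m : ℕ} (hx : x ∈ A ^ m) : x⁻¹ ∈ A ^ m := by
  rw [← hA.inv_eq, inv_pow]; exact inv_mem_inv hx

lemma pow_subset (hA : IsSlow A L) {m n : ℕ} (h : m ≤ n) : A ^ m ⊆ A ^ n :=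
  pow_subset_pow_right hA.one_mem h

lemma card_pos (hA : IsSlow A L) : 0 < #A := Finset.card_pos.2 ⟨1, hA.one_mem⟩

lemma conj_mem (hA : IsSlow A L) {a g : SL2 F} {m : ℕ} (ha : a ∈ A) (hg : g ∈ A ^ m) :
    a * g * a⁻¹ ∈ A ^ (m + 2) := by
  rw [← pow_one A] at ha
  exact mul_mem_pow_add (mul_mem_pow_add ha hg rfl) (hA.inv_mem_pow ha) (by omega)

set_option maxRecDepth 2000 in
/-- Slowly growing sets have few elements of a given nonzero trace. -/
lemma card_pow_three_le (hA : IsSlow A L) (h2 : (2 : F) ≠ 0) {t : F} (ht : t ≠ 0)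
    {W : Finset (SL2 F)} (hWA : W ⊆ A ^ 6) (hW : ∀ x ∈ W, ¬ IsScalar x ∧ tr x = t) :
    #W ^ 3 ≤ L ^ 32 * #A ^ 2 := by
  have hβ : ∀ w : Fin 2 → F, w ≠ 0 → #{y ∈ W | y ∈ borel w} ≤ 2 * Nat.sqrt #(A ^ 26) := by
    intro w hw
    refine (card_filter_borel_le (S := A ^ 12) (fun x hx ↦ (hW x hx).2) (fun x hx y hy ↦
      ⟨mul_mem_pow_add (hA.inv_mem_pow (hWA hx)) (hWA hy) (by norm_num),
        mul_mem_pow_add (hWA hx) (hWA hy) (by norm_num)⟩)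
      hw).trans (Nat.mul_le_mul_left 2 (Nat.le_sqrt'.2 ?_))
    obtain ⟨a, ha, haw⟩ := hA.exists_notMem_borel w hw
    exact card_filter_unip_sq_le (T := A ^ 26) hw haw fun u hu v hv ↦
      mul_mem_pow_add hu (hA.conj_mem ha hv) rfl
  have hmain := SLTwo.card_pow_three_le (S := A ^ 12) h2 ht hW (fun x hx y hy ↦
    mul_mem_pow_add (hA.inv_mem_pow (hWA hx)) (hWA hy) (by norm_num)) hβ
  have hs := Nat.sqrt_le' #(A ^ 26)
  have h12 := hA.card_pow_le 12 (by norm_num)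
  have h26 := hA.card_pow_le 26 (by norm_num)
  have h6 := (card_le_card hWA).trans (hA.card_pow_le 6 (by norm_num))
  norm_num at h12 h26 h6
  have hL : 1 ≤ L := one_le_two.trans hA.two_le
  have e1 : #(A ^ 12) ^ 2 ≤ L ^ 28 * #A ^ 2 := by
    calc _ ≤ (L ^ 10 * #A) ^ 2 := by gcongr
      _ = L ^ 20 * #A ^ 2 := by ring
      _ ≤ _ := by gcongr; norm_num
  have e2 : #W ^ 2 ≤ L ^ 28 * #A ^ 2 := by
    calc _ ≤ (L ^ 4 * #A) ^ 2 := by gcongr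
      _ = L ^ 8 * #A ^ 2 := by ring
      _ ≤ _ := by gcongr; norm_num
  have e3 : Nat.sqrt #(A ^ 26) ^ 2 * #W ≤ L ^ 28 * #A ^ 2 := by
    calc _ ≤ (L ^ 24 * #A) * (L ^ 4 * #A) := by gcongr; exact hs.trans h26
      _ = _ := by ring
  have e4 : 2 ^ 4 ≤ L ^ 4 := Nat.pow_le_pow_left hA.two_le 4
  calc #W ^ 3 ≤ 2 ^ 4 * (L ^ 28 * #A ^ 2) := by nlinarith
    _ ≤ L ^ 4 * (L ^ 28 * #A ^ 2) := by gcongr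
    _ = _ := by ring

/-- Slowly growing sets contain many elements of each centralizer of an element of small height. -/
lemma card_le_of_commute (hA : IsSlow A L) (h2 : (2 : F) ≠ 0) {g : SL2 F} (hg : g ∈ A ^ 4)
    (hgs : ¬ IsScalar g) (hgt : tr g ≠ 0) :
    #A ≤ L ^ 32 * #{y ∈ A ^ 2 | Commute y g} ^ 3 := by
  set W := A.image fun a ↦ a * g * a⁻¹
  have hW : #W ^ 3 ≤ L ^ 32 * #A ^ 2 := by
    refine hA.card_pow_three_le h2 hgt (fun x hx ↦ ?_) (fun x hx ↦ ?_) <;>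
      obtain ⟨a, ha, rfl⟩ := mem_image.1 hx
    · exact hA.conj_mem ha hg
    · exact ⟨fun h ↦ hgs (isScalar_conj_iff.1 h), tr_conj a g⟩
  have hc : #A ≤ #{y ∈ A ^ 2 | Commute y g} * #W := by
    refine card_le_mul_card_image_of_maps_to (f := fun a ↦ a * g * a⁻¹)
      (fun a ha ↦ mem_image_of_mem _ ha) _ fun x hx ↦ ?_
    obtain ⟨b, hb, rfl⟩ := mem_image.1 hx
    refine card_le_card_of_injOn (fun a ↦ b⁻¹ * a) (fun a ha ↦ ?_)
      (mul_right_injective _).injOn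
    simp only [coe_filter, Set.mem_ofPred_eq] at ha ⊢
    refine ⟨?_, ?_⟩
    · rw [← pow_one A] at ha hb
      exact mul_mem_pow_add (hA.inv_mem_pow hb) ha.1 (by norm_num)
    · rw [commute_iff_eq]
      have := ha.2
      rw [mul_inv_eq_iff_eq_mul] at this
      rw [mul_assoc, this]; group
  have h3 : #A ^ 3 ≤ #{y ∈ A ^ 2 | Commute y g} ^ 3 * (L ^ 32 * #A ^ 2) :=
    calc _ ≤ (#{y ∈ A ^ 2 | Commute y g} * #W) ^ 3 := by gcongr
      _ = #{y ∈ A ^ 2 | Commute y g} ^ 3 * #W ^ 3 := by ring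
      _ ≤ _ := by gcongr
  have hp := pow_pos hA.card_pos 2
  refine Nat.le_of_mul_le_mul_right ?_ hp
  linarith

end IsSlow

end Growth

end SLTwo

namespace SLTwo

open Finset

open scoped Classical

section Regular

variable {F : Type*} [Field F]

/-- An element of `SL₂` is good if its trace is not `0`, `2` or `-2`. -/
def IsGood (g : SL2 F) : Prop := tr g ≠ 0 ∧ tr g ≠ 2 ∧ tr g ≠ -2

lemma IsGood.not_isScalar {g : SL2 F} (hg : IsGood g) : ¬ IsScalar g :=
  not_isScalar_of_tr hg.2.1 hg.2.2

lemma IsGood.conj {g : SL2 F} (hg : IsGood g) (x : SL2 F) : IsGood (x * g * x⁻¹) := by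
  unfold IsGood at *; rwa [tr_conj]

lemma card_le_two_of_commute {S : Finset (SL2 F)} {g : SL2 F} {t : F} (h2 : (2 : F) ≠ 0)
    (hg : tr g ≠ 2) (hg' : tr g ≠ -2) (hS : ∀ y ∈ S, Commute y g ∧ tr y = t) : #S ≤ 2 := by
  rcases S.eq_empty_or_nonempty with rfl | ⟨k, hk⟩
  · simp
  refine (card_le_card (t := {k, k⁻¹}) fun l hl ↦ ?_).trans card_le_two
  rw [mem_insert, mem_singleton]
  exact eq_or_eq_inv_of_commute h2 hg hg' (hS k hk).1 (hS l hl).1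
    ((hS l hl).2.trans (hS k hk).2.symm)

lemma exists_isGood_of_card {S : Finset (SL2 F)} {g : SL2 F} (h2 : (2 : F) ≠ 0)
    (hg : tr g ≠ 2) (hg' : tr g ≠ -2) (hS : ∀ y ∈ S, Commute y g) (hc : 6 < #S) :
    ∃ y ∈ S, IsGood y := by
  by_contra! hcon
  have hsub : S ⊆ {y ∈ S | tr y = 0} ∪ ({y ∈ S | tr y = 2} ∪ {y ∈ S | tr y = -2}) := by
    intro y hy
    have := hcon y hy
    simp only [IsGood] at this
    simp only [mem_union, mem_filter]
    tauto
  have key : ∀ t : F, #{y ∈ S | tr y = t} ≤ 2 := fun t ↦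
    card_le_two_of_commute h2 hg hg' fun y hy ↦ ⟨hS y (mem_filter.1 hy).1, (mem_filter.1 hy).2⟩
  have h := (card_le_card hsub).trans ((card_union_le _ _).trans
    (Nat.add_le_add_left (card_union_le _ _) _))
  have := key 0
  have := key 2
  have := key (-2)
  omega

variable [DecidableEq F] {A : Finset (SL2 F)} {L : ℕ}

namespace IsSlow

lemma six_lt_card (hA : IsSlow A L) (hN : L ^ 44 < #A) {c : ℕ} (hc : #A ≤ L ^ 32 * c ^ 3) :
    6 < c := by
  by_contra! h
  have h1 : 2 ^ 12 ≤ L ^ 12 := Nat.pow_le_pow_left hA.two_le _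
  have h2 : c ^ 3 ≤ 6 ^ 3 := Nat.pow_le_pow_left h 3
  have : L ^ 32 * c ^ 3 ≤ L ^ 32 * L ^ 12 := Nat.mul_le_mul_left _ (by omega)
  rw [← pow_add] at this
  norm_num at this
  omega

lemma exists_isGood_commute (hA : IsSlow A L) (h2 : (2 : F) ≠ 0) (hN : L ^ 44 < #A) {g : SL2 F}
    (hg : g ∈ A ^ 4) (hgood : IsGood g) : ∃ h ∈ A ^ 2, IsGood h ∧ Commute h g := by
  obtain ⟨h, hh, hhg⟩ := exists_isGood_of_card (S := {y ∈ A ^ 2 | Commute y g}) h2 hgood.2.1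
    hgood.2.2 (fun y hy ↦ (mem_filter.1 hy).2) (hA.six_lt_card hN
      (hA.card_le_of_commute h2 hg hgood.not_isScalar hgood.1))
  exact ⟨h, (mem_filter.1 hh).1, hhg, (mem_filter.1 hh).2⟩

lemma exists_isGood (hA : IsSlow A L) (h2 : (2 : F) ≠ 0) (hN : L ^ 44 < #A) :
    ∃ h ∈ A ^ 2, IsGood h := by
  by_contra! hcon
  set T : F → Finset (SL2 F) := fun t ↦ {y ∈ A ^ 2 | ¬ IsScalar y ∧ tr y = t} with hT
  have hTc : ∀ t, t ≠ 0 → #(T t) ^ 3 ≤ L ^ 32 * #A ^ 2 := fun t ht ↦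
    hA.card_pow_three_le h2 ht ((filter_subset _ _).trans (hA.pow_subset (by norm_num)))
      fun x hx ↦ (mem_filter.1 hx).2
  set B : Finset (SL2 F) := {1, -1} ∪ (T 2 ∪ T (-2)) with hB
  have hBc : #B ≤ 2 + (#(T 2) + #(T (-2))) := (card_union_le _ _).trans
    (add_le_add card_le_two (card_union_le _ _))
  have htr : ∀ y ∈ A ^ 2, y ∉ B → tr y = 0 := by
    intro y hy hyB
    by_contra h0
    have hgood := hcon y hy
    simp only [hB, hT, mem_union, mem_insert, mem_singleton, mem_filter, not_or] at hyB
    have hs : ¬ IsScalar y := fun h ↦ (eq_one_or_eq_neg_one_of_isScalar h).elim hyB.1.1 hyB.1.2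
    exact hgood ⟨h0, fun h ↦ hyB.2.1 ⟨hy, hs, h⟩, fun h ↦ hyB.2.2 ⟨hy, hs, h⟩⟩
  clear_value B
  have hA2 : ∀ {x}, x ∈ A → x ∈ A ^ 2 := fun hx ↦
    hA.pow_subset one_le_two (by rwa [pow_one])
  have hAA : ∀ {x y}, x ∈ A → y ∈ A → x * y ∈ A ^ 2 := fun hx hy ↦ by
    rw [sq]; exact mul_mem_mul hx hy
  have himg : ∀ x : SL2 F, #(B.image (x⁻¹ * ·)) = #B := fun x ↦
    card_image_of_injective _ (mul_right_injective _)
  have hmem : ∀ {x y : SL2 F}, y ∉ B.image (x⁻¹ * ·) → x * y ∉ B := fun {x y} h h' ↦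
    h (mem_image.2 ⟨x * y, h', by simp⟩)
  have hsmall : #A ≤ 3 * #B + 2 := by
    by_contra! hbig
    have c1 : 0 < #(A \ B) := by have := le_card_sdiff B A; omega
    obtain ⟨x, hx⟩ := Finset.card_pos.1 c1
    rw [mem_sdiff] at hx
    have c2 : 0 < #(A \ (B ∪ B.image (x⁻¹ * ·))) := by
      have h1 := le_card_sdiff (B ∪ B.image (x⁻¹ * ·)) A
      have h2 := card_union_le B (B.image (x⁻¹ * ·))
      rw [himg] at h2
      omega
    obtain ⟨y, hy⟩ := Finset.card_pos.1 c2
    rw [mem_sdiff, mem_union, not_or] at hy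
    have c3 : 2 < #(A \ (B ∪ (B.image (x⁻¹ * ·) ∪ B.image (y⁻¹ * ·)))) := by
      have h1 := le_card_sdiff (B ∪ (B.image (x⁻¹ * ·) ∪ B.image (y⁻¹ * ·))) A
      have h2 := (card_union_le B (B.image (x⁻¹ * ·) ∪ B.image (y⁻¹ * ·))).trans
        (Nat.add_le_add_left (card_union_le _ _) _)
      rw [himg, himg] at h2
      omega
    have hx0 := htr x (hA2 hx.1) hx.2
    have hy0 := htr y (hA2 hy.1) hy.2.1
    have hxy := htr _ (hAA hx.1 hy.1) (hmem hy.2.2)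
    refine c3.not_ge (card_le_two_of_commute (g := x * y) (t := 0) h2 ?_ ?_ fun z hz ↦ ?_)
    · rw [hxy]; exact h2.symm
    · rw [hxy]; exact (neg_ne_zero.2 h2).symm
    · rw [mem_sdiff, mem_union, mem_union, not_or, not_or] at hz
      have hz0 := htr z (hA2 hz.1) hz.2.1
      exact ⟨commute_mul_of_tr_eq_zero hx0 hy0 hz0 (htr _ (hAA hx.1 hz.1) (hmem hz.2.2.1))
        (htr _ (hAA hy.1 hz.1) (hmem hz.2.2.2)), hz0⟩
  obtain ⟨M, hM, hM2, hM2'⟩ : ∃ M, M ^ 3 ≤ L ^ 32 * #A ^ 2 ∧ #(T 2) ≤ M ∧ #(T (-2)) ≤ M := by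
    rcases le_total #(T 2) #(T (-2)) with h | h
    · exact ⟨_, hTc _ (neg_ne_zero.2 h2), h, le_rfl⟩
    · exact ⟨_, hTc _ h2, le_rfl, h⟩
  have h1 : 2 ^ 12 ≤ L ^ 12 := Nat.pow_le_pow_left hA.two_le _
  have h32 : 1 ≤ L ^ 32 := Nat.one_le_pow _ _ (by have := hA.two_le; omega)
  have h44 : L ^ 44 = L ^ 12 * L ^ 32 := by ring
  have hM0 : #A ≤ 14 * M := by
    rcases Nat.eq_zero_or_pos M with rfl | hpos
    · nlinarith
    · omega
  have h3 : #A ^ 3 ≤ (14 ^ 3 * L ^ 32) * #A ^ 2 :=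
    calc #A ^ 3 ≤ (14 * M) ^ 3 := by gcongr
      _ = 14 ^ 3 * M ^ 3 := by ring
      _ ≤ 14 ^ 3 * (L ^ 32 * #A ^ 2) := by gcongr
      _ = _ := by ring
  have h4 : #A ≤ 14 ^ 3 * L ^ 32 :=
    Nat.le_of_mul_le_mul_right (by linarith) (pow_pos hA.card_pos 2)
  nlinarith

lemma exists_isGood_commute_conj (hA : IsSlow A L) (h2 : (2 : F) ≠ 0) (hN : L ^ 44 < #A)
    (x : SL2 F) (hx : x ∈ Submonoid.closure (A : Set (SL2 F))) :
    ∀ h ∈ A ^ 2, IsGood h → ∃ h' ∈ A ^ 2, IsGood h' ∧ Commute h' (x * h * x⁻¹) := by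
  induction hx using Submonoid.closure_induction with
  | mem a ha =>
    exact fun h hh hg ↦ hA.exists_isGood_commute h2 hN (hA.conj_mem ha hh) (hg.conj a)
  | one => exact fun h hh hg ↦ ⟨h, hh, hg, by simp⟩
  | mul x y _ _ ihx ihy =>
    intro h hh hg
    obtain ⟨h₁, hh₁, hg₁, c₁⟩ := ihy h hh hg
    obtain ⟨h₂, hh₂, hg₂, c₂⟩ := ihx h₁ hh₁ hg₁
    refine ⟨h₂, hh₂, hg₂, commute_trans (hg₁.conj x).not_isScalar c₂ ?_⟩
    have := (Commute.conj_iff x).2 c₁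
    simpa [mul_assoc] using this

end IsSlow

end Regular

section Counting

variable {F : Type*} [Field F] [Fintype F] [DecidableEq F]

lemma card_commute_le {g : SL2 F} (h2 : (2 : F) ≠ 0) (hg : IsGood g) :
    #{z : SL2 F | Commute z g} ≤ 2 * Fintype.card F := by
  refine card_le_mul_card_image_of_maps_to (f := tr) (fun _ _ ↦ mem_univ _) 2 fun t _ ↦ ?_
  refine card_le_two_of_commute (g := g) (t := t) h2 hg.2.1 hg.2.2 fun y hy ↦ ?_
  simpa using hy

lemma card_commute_conj_le {g : SL2 F} (h2 : (2 : F) ≠ 0) (hg : IsGood g) :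
    #{z : SL2 F | Commute (z * g * z⁻¹) g} ≤ 4 * Fintype.card F := by
  have h : #{z : SL2 F | Commute (z * g * z⁻¹) g} ≤
      #{z : SL2 F | Commute z g} * #({g, g⁻¹} : Finset (SL2 F)) := by
    refine card_le_mul_card_image_of_maps_to (f := fun z ↦ z * g * z⁻¹) (fun z hz ↦ ?_) _
      fun k _ ↦ ?_
    · rw [mem_insert, mem_singleton]
      exact eq_or_eq_inv_of_commute h2 hg.2.1 hg.2.2 (Commute.refl g) (by simpa using hz)
        (tr_conj z g)
    · rcases (filter (fun z ↦ z * g * z⁻¹ = k)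
        {z : SL2 F | Commute (z * g * z⁻¹) g}).eq_empty_or_nonempty with h | ⟨z₀, hz₀⟩
      · rw [h]; simp
      refine card_le_card_of_injOn (fun z ↦ z₀⁻¹ * z) (fun z hz ↦ ?_)
        (mul_right_injective _).injOn
      simp only [coe_filter, mem_filter, mem_univ, true_and, Set.mem_ofPred_eq] at hz hz₀ ⊢
      have := hz.2.trans hz₀.2.symm
      rw [mul_inv_eq_iff_eq_mul] at this
      rw [commute_iff_eq, mul_assoc, this]; group
  have h1 := card_commute_le h2 hg
  have h3 : #({g, g⁻¹} : Finset (SL2 F)) ≤ 2 := card_le_two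
  nlinarith

lemma card_field_pow_three_le : Fintype.card F ^ 3 ≤ 2 * Fintype.card (SL2 F) := by
  have h : Fintype.card (Fˣ × F × F) ≤ Fintype.card (SL2 F) := by
    refine Fintype.card_le_of_injective
      (fun q ↦ (⟨!![(q.1 : F), q.2.1; q.2.2, (1 + q.2.1 * q.2.2) * (q.1⁻¹ : Fˣ)], ?_⟩ : SL2 F)) ?_
    · rw [Matrix.det_fin_two_of, mul_left_comm, Units.mul_inv]; ring
    · rintro ⟨a, b, c⟩ ⟨a', b', c'⟩ e
      have e' := congrArg Subtype.val e
      have e0 := congrFun (congrFun e' 0) 0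
      have e1 := congrFun (congrFun e' 0) 1
      have e2 := congrFun (congrFun e' 1) 0
      simp at e0 e1 e2
      rw [Units.ext e0, e1, e2]
  rw [Fintype.card_prod, Fintype.card_prod, Fintype.card_units] at h
  obtain ⟨q, hq⟩ : ∃ q, Fintype.card F = q + 2 :=
    Nat.exists_eq_add_of_le' Fintype.one_lt_card
  rw [hq, show q + 2 - 1 = q + 1 by omega] at h
  rw [hq]
  nlinarith

/-- A slowly growing generating set of `SL₂` over a finite field is either small or has positive
density. -/
lemma IsSlow.card_le {A : Finset (SL2 F)} {L : ℕ} (hA : IsSlow A L) (h2 : (2 : F) ≠ 0)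
    (hgen : Submonoid.closure (A : Set (SL2 F)) = ⊤) (hN : L ^ 44 < #A) :
    Fintype.card (SL2 F) ≤ L ^ 23 * #A := by
  obtain ⟨h, hh, hg⟩ := hA.exists_isGood h2 hN
  have hex : ∃ m, #A ≤ L ^ 32 * m ^ 3 := by
    refine ⟨#A, (Nat.le_self_pow three_ne_zero _).trans (Nat.le_mul_of_pos_left _ ?_)⟩
    exact Nat.pow_pos (by have := hA.two_le; omega)
  obtain ⟨m, hm, hmin⟩ : ∃ m, #A ≤ L ^ 32 * m ^ 3 ∧ ∀ c, #A ≤ L ^ 32 * c ^ 3 → m ≤ c :=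
    ⟨Nat.find hex, Nat.find_spec hex, fun c hc ↦ Nat.find_min' hex hc⟩
  have h6 := hA.six_lt_card hN hm
  have hcount : #(univ : Finset (SL2 F)) * (m - 2) ≤ #{y ∈ A ^ 2 | ¬ IsScalar y} *
      (4 * Fintype.card F) := by
    refine card_mul_le_card_mul (fun x y ↦ Commute y (x * h * x⁻¹)) (fun x _ ↦ ?_) fun y hy ↦ ?_
    · obtain ⟨h', hh', hg', hc'⟩ := hA.exists_isGood_commute_conj h2 hN x (by simp [hgen]) h hh hg
      have hc := hmin _ (hA.card_le_of_commute h2 (hA.pow_subset (by norm_num) hh')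
        hg'.not_isScalar hg'.1)
      have hsub : {y ∈ A ^ 2 | Commute y h'} ⊆ {1, -1} ∪ bipartiteAbove
          (fun x y ↦ Commute y (x * h * x⁻¹)) {y ∈ A ^ 2 | ¬ IsScalar y} x := by
        intro y hy
        rw [mem_filter] at hy
        rw [mem_union, mem_insert, mem_singleton, bipartiteAbove, mem_filter, mem_filter]
        by_cases hs : IsScalar y
        · exact .inl (eq_one_or_eq_neg_one_of_isScalar hs)
        · exact .inr ⟨⟨hy.1, hs⟩, commute_trans hg'.not_isScalar hy.2 hc'⟩
      have := (card_le_card hsub).trans ((card_union_le _ _).trans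
        (Nat.add_le_add_right card_le_two _))
      omega
    · rw [mem_filter] at hy
      refine le_trans ?_ (card_commute_conj_le h2 hg)
      rcases (bipartiteBelow (fun x y ↦ Commute y (x * h * x⁻¹)) univ y).eq_empty_or_nonempty
        with e | ⟨x₀, hx₀⟩
      · rw [e]; simp
      refine card_le_card_of_injOn (fun z ↦ x₀⁻¹ * z) (fun z hz ↦ ?_)
        (mul_right_injective _).injOn
      simp only [bipartiteBelow, coe_filter, mem_filter, mem_univ, true_and,
        Set.mem_ofPred_eq] at hz hx₀ ⊢
      have hc := commute_trans hy.2 hz.symm hx₀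
      have := (Commute.conj_iff x₀⁻¹).2 hc
      simpa [mul_assoc] using this
  have hA2 : #{y ∈ A ^ 2 | ¬ IsScalar y} ≤ L * #A := by
    refine (card_filter_le _ _).trans ((card_le_card (hA.pow_subset (by norm_num))).trans
      ((hA.card_pow_le 3 le_rfl).trans ?_))
    norm_num
  rw [card_univ] at hcount
  set n := Fintype.card (SL2 F)
  set q := Fintype.card F
  have hq : q ^ 3 ≤ 2 * n := card_field_pow_three_le
  have hn : 0 < n := Fintype.card_pos
  have e1 : n * m ≤ 8 * q * (L * #A) := by
    have h1 : m ≤ 2 * (m - 2) := by omega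
    calc n * m ≤ n * (2 * (m - 2)) := by gcongr
      _ = 2 * (n * (m - 2)) := by ring
      _ ≤ 2 * (L * #A * (4 * q)) := Nat.mul_le_mul_left 2 (hcount.trans (by gcongr))
      _ = _ := by ring
  have hNpos := hA.card_pos
  have e2 : n ^ 2 * (n * #A) ≤ (1024 * L ^ 35 * #A ^ 2) * (n * #A) :=
    calc n ^ 2 * (n * #A) ≤ n ^ 2 * (n * (L ^ 32 * m ^ 3)) := by gcongr
      _ = L ^ 32 * (n * m) ^ 3 := by ring
      _ ≤ L ^ 32 * (8 * q * (L * #A)) ^ 3 := by gcongr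
      _ = 512 * L ^ 35 * #A ^ 3 * q ^ 3 := by ring
      _ ≤ 512 * L ^ 35 * #A ^ 3 * (2 * n) := by gcongr
      _ = _ := by ring
  have e3 := Nat.le_of_mul_le_mul_right e2 (by positivity)
  have h10 : 2 ^ 11 ≤ L ^ 11 := Nat.pow_le_pow_left hA.two_le _
  refine (Nat.pow_le_pow_iff_left two_ne_zero).1 ?_
  calc n ^ 2 ≤ 1024 * L ^ 35 * #A ^ 2 := e3
    _ ≤ L ^ 11 * L ^ 35 * #A ^ 2 := by gcongr; omega
    _ = _ := by ring

end Counting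

end SLTwo

namespace SLTwo

section Solvable

lemma isSolvable_of_commute_subgroup {G : Type*} [Group G] (N : Subgroup G)
    (hN : ∀ g h : G, g * h * g⁻¹ * h⁻¹ ∈ N) (hcomm : ∀ x ∈ N, ∀ y ∈ N, x * y = y * x) :
    Group.IsSolvable G := by
  have h1 : commutator G ≤ N := by
    rw [commutator_def, Subgroup.commutator_le]
    exact fun g _ h _ ↦ hN g h
  refine ⟨⟨2, ?_⟩⟩
  rw [derivedSeries_succ, derivedSeries_one, eq_bot_iff, Subgroup.commutator_le]
  intro x hx y hy
  rw [Subgroup.mem_bot, commutatorElement_eq_one_iff_mul_comm]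
  exact hcomm x (h1 hx) y (h1 hy)

lemma isSolvable_of_le {G : Type*} [Group G] {H K : Subgroup G} (h : H ≤ K)
    (hK : Group.IsSolvable K) : Group.IsSolvable H :=
  Group.isSolvable_of_isSolvable_injective (Subgroup.inclusion_injective h)

variable {F : Type*} [Field F]

lemma commute_of_mem_unip {w : Fin 2 → F} (hw : w ≠ 0) {x y : SL2 F} (hx : x ∈ unip w)
    (hy : y ∈ unip w) : Commute x y := by
  rw [mem_unip_iff] at hx hy
  obtain ⟨x0, x1⟩ := hx
  obtain ⟨y0, y1⟩ := hy
  have dx := det_eq x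
  have dy := det_eq y
  rw [commute_iff]
  rcases vec_ne_zero hw with h | h <;>
  refine ⟨?_, ?_, ?_⟩ <;> apply mul_left_cancel₀ (pow_ne_zero 2 h) <;> grind

lemma isSolvable_borel {w : Fin 2 → F} (hw : w ≠ 0) : Group.IsSolvable (borel w) := by
  refine isSolvable_of_commute_subgroup ((unip w).subgroupOf (borel w)) ?_ ?_
  · rintro ⟨g, c, hc⟩ ⟨h, d, hd⟩
    rw [Subgroup.mem_subgroupOf]
    have key : (g * h).1.mulVec w = (h * g).1.mulVec w := by
      rw [Matrix.SpecialLinearGroup.coe_mul, Matrix.SpecialLinearGroup.coe_mul,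
        ← Matrix.mulVec_mulVec, ← Matrix.mulVec_mulVec, hd, hc, Matrix.mulVec_smul,
        Matrix.mulVec_smul, hc, hd, smul_comm]
    obtain ⟨e, he⟩ := (borel w).inv_mem ((borel w).mul_mem (⟨d, hd⟩ : h ∈ borel w) ⟨c, hc⟩)
    change (g * h * g⁻¹ * h⁻¹).1.mulVec w = w
    have e1 : g * h * g⁻¹ * h⁻¹ = (g * h) * (h * g)⁻¹ := by group
    have e2 : ((h * g) * (h * g)⁻¹).1.mulVec w = w := by simp
    rw [Matrix.SpecialLinearGroup.coe_mul, ← Matrix.mulVec_mulVec, he, Matrix.mulVec_smul] at e2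
    rw [e1, Matrix.SpecialLinearGroup.coe_mul, ← Matrix.mulVec_mulVec, he, Matrix.mulVec_smul, key,
      e2]
  · intro x hx y hy
    exact Subtype.ext (commute_of_mem_unip hw hx hy)

end Solvable

section Unipotent

variable {F : Type*} [Field F]

lemma exists_mem_unip_of_tr_eq_two {u : SL2 F} (h : tr u = 2) :
    ∃ w : Fin 2 → F, w ≠ 0 ∧ u ∈ unip w := by
  have hd := det_eq u
  rw [tr] at h
  by_cases h0 : u 0 0 - 1 = 0 ∧ u 1 0 = 0
  · refine ⟨![1, 0], fun e ↦ by simpa using congr_fun e 0, ?_⟩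
    rw [mem_unip_iff]
    simp only [Matrix.cons_val_zero, Matrix.cons_val_one]
    grind
  · refine ⟨![u 0 0 - 1, u 1 0], fun e ↦ h0 ⟨congr_fun e 0, congr_fun e 1⟩, ?_⟩
    rw [mem_unip_iff]
    simp only [Matrix.cons_val_zero, Matrix.cons_val_one]
    grind

lemma isScalar_eq_one {w : Fin 2 → F} (hw : w ≠ 0) {u : SL2 F} (hu : u ∈ unip w)
    (hs : IsScalar u) : u = 1 := by
  rw [mem_unip_iff] at hu
  obtain ⟨s1, s2, s3⟩ := hs
  have : u 0 0 = 1 := by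
    rcases vec_ne_zero hw with h | h <;> apply mul_left_cancel₀ h <;> grind
  apply ext_entries <;> simp <;> grind

lemma tr_eq_two_of_mem_unip {w : Fin 2 → F} (hw : w ≠ 0) {u : SL2 F} (hu : u ∈ unip w) :
    tr u = 2 := by
  have hd := det_eq u
  rw [mem_unip_iff] at hu
  rw [tr]
  rcases vec_ne_zero hw with h | h <;> apply mul_left_cancel₀ h <;> grind

lemma pow_entries {u : SL2 F} (h : tr u = 2) (k : ℕ) :
    (u ^ k) 0 0 = 1 - k + k * u 0 0 ∧ (u ^ k) 0 1 = k * u 0 1 ∧ (u ^ k) 1 0 = k * u 1 0 ∧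
      (u ^ k) 1 1 = 1 - k + k * u 1 1 := by
  have hd := det_eq u
  rw [tr] at h
  induction k with
  | zero => simp
  | succ k ih =>
    obtain ⟨a, b, c, d⟩ := ih
    simp only [pow_succ, mul_entry, a, b, c, d]
    push_cast
    refine ⟨?_, ?_, ?_, ?_⟩ <;> grind

lemma exists_unip_map {w v v' : Fin 2 → F} (h : w 0 * v 1 - w 1 * v 0 ≠ 0)
    (e : w 0 * v 1 - w 1 * v 0 = w 0 * v' 1 - w 1 * v' 0) :
    ∃ u ∈ unip w, u.1.mulVec v = v' := by
  obtain ⟨c, hc⟩ : ∃ c, c = w 0 * v 1 - w 1 * v 0 := ⟨_, rfl⟩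
  rw [← hc] at h e
  obtain ⟨s, hs0, hs1⟩ : ∃ s, v' 0 = v 0 + s * c * w 0 ∧ v' 1 = v 1 + s * c * w 1 := by
    by_cases hw : w 0 = 0
    · have h1 : w 1 ≠ 0 := by rintro h1; apply h; simp [hc, hw, h1]
      refine ⟨(v' 1 - v 1) / (c * w 1), ?_, ?_⟩
      · apply mul_left_cancel₀ h1; rw [hw] at hc e ⊢; linear_combination e - hc
      · field_simp; ring
    · refine ⟨(v' 0 - v 0) / (c * w 0), ?_, ?_⟩
      · field_simp; ring
      · apply mul_left_cancel₀ hw; field_simp; linear_combination hc - e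
  obtain ⟨u, u0, u1, u2, u3⟩ : ∃ u : SL2 F, u 0 0 = 1 - s * w 0 * w 1 ∧ u 0 1 = s * w 0 ^ 2 ∧
      u 1 0 = -s * w 1 ^ 2 ∧ u 1 1 = 1 + s * w 0 * w 1 :=
    ⟨⟨!![1 - s * w 0 * w 1, s * w 0 ^ 2; -s * w 1 ^ 2, 1 + s * w 0 * w 1], by
      rw [Matrix.det_fin_two_of]; ring⟩, rfl, rfl, rfl, rfl⟩
  refine ⟨u, ?_, ?_⟩
  · rw [mem_unip_iff, u0, u1, u2, u3]
    constructor <;> ring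
  · ext i
    fin_cases i <;>
      simp [Matrix.mulVec, dotProduct, Fin.sum_univ_two, hs0, hs1, u0, u1, u2, u3, hc] <;> ring

/-- Two distinct full unipotent subgroups generate `SL₂`. -/
lemma eq_top_of_unip_le {w w' : Fin 2 → F} {Γ : Subgroup (SL2 F)} (h : w 0 * w' 1 - w 1 * w' 0 ≠ 0)
    (hw : unip w ≤ Γ) (hw' : unip w' ≤ Γ) : Γ = ⊤ := by
  have first : ∀ v : Fin 2 → F, w 0 * v 1 - w 1 * v 0 ≠ 0 → ∃ x ∈ Γ, x.1.mulVec w = v := by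
    intro v hv
    set t := (w 0 * v 1 - w 1 * v 0) / (w 0 * w' 1 - w 1 * w' 0) with ht
    have ht' : t * (w 0 * w' 1 - w 1 * w' 0) = w 0 * v 1 - w 1 * v 0 := div_mul_cancel₀ _ h
    obtain ⟨u₂, hu₂, e₂⟩ := exists_unip_map (w := w') (v := w) (v' := w + t • w')
      (fun e ↦ h (by linear_combination -e)) (by simp; ring)
    obtain ⟨u₁, hu₁, e₁⟩ := exists_unip_map (w := w) (v := w + t • w') (v' := v)
      (by simp; grind) (by simp; grind)
    exact ⟨u₁ * u₂, Γ.mul_mem (hw hu₁) (hw' hu₂), by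
      rw [Matrix.SpecialLinearGroup.coe_mul, ← Matrix.mulVec_mulVec, e₂, e₁]⟩
  have second : ∀ v : Fin 2 → F, v ≠ 0 → ∃ x ∈ Γ, x.1.mulVec w = v := by
    intro v hv
    by_cases hc : w 0 * v 1 - w 1 * v 0 = 0
    · obtain ⟨u, hu, e⟩ := exists_unip_map (w := w') (v := v + w') (v' := v) (by
        simp only [Pi.add_apply]
        intro hc'
        rcases vec_ne_zero hv with h0 | h0 <;> apply h0 <;> apply mul_left_cancel₀ h <;> grind)
        (by simp; ring)
      obtain ⟨x, hx, ex⟩ := first (v + w') (by simp; grind)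
      exact ⟨u * x, Γ.mul_mem (hw' hu) hx, by
        rw [Matrix.SpecialLinearGroup.coe_mul, ← Matrix.mulVec_mulVec, ex, e]⟩
    · exact first v hc
  rw [eq_top_iff]
  intro g _
  have hw0 : w ≠ 0 := by rintro rfl; simp at h
  have inv_mul : ∀ (x : SL2 F) (v : Fin 2 → F), x⁻¹.1.mulVec (x.1.mulVec v) = v := by
    intro x v
    rw [Matrix.mulVec_mulVec, ← Matrix.SpecialLinearGroup.coe_mul]
    simp
  obtain ⟨x, hx, e⟩ := second (g.1.mulVec w) (fun h0 ↦ hw0 (by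
    rw [← inv_mul g w, h0, Matrix.mulVec_zero]))
  have : x⁻¹ * g ∈ unip w := by
    change (x⁻¹ * g).1.mulVec w = w
    rw [Matrix.SpecialLinearGroup.coe_mul, ← Matrix.mulVec_mulVec, ← e, inv_mul]
  simpa using Γ.mul_mem hx (hw this)

end Unipotent

section ZModp

variable {p : ℕ} [Fact p.Prime]

lemma unip_le_of_mem {w : Fin 2 → ZMod p} (hw : w ≠ 0) {u : SL2 (ZMod p)} (h1 : u ≠ 1)
    (hu : u ∈ unip w) {Γ : Subgroup (SL2 (ZMod p))} (h : u ∈ Γ) : unip w ≤ Γ := by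
  intro v hv
  have hs : ¬ IsScalar u := fun hs ↦ h1 (isScalar_eq_one hw hu hs)
  obtain ⟨a, b, e0, e1, e2, e3⟩ := exists_affine_of_commute hs (commute_of_mem_unip hw hu hv)
  have hu' := mem_unip_iff.1 hu
  have hv' := mem_unip_iff.1 hv
  have hab : a = 1 - b := by
    rcases vec_ne_zero hw with h | h <;> apply mul_left_cancel₀ h <;> grind
  obtain ⟨k, rfl⟩ := ZMod.natCast_zmod_surjective b
  obtain ⟨p0, p1, p2, p3⟩ := pow_entries (tr_eq_two_of_mem_unip hw hu) k
  have : v = u ^ k := by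
    apply ext_entries <;> simp only [p0, p1, p2, p3, e0, e1, e2, e3, hab]
  exact this ▸ Γ.pow_mem h k

lemma isSolvable_or_eq_top_of_tr_eq_two {Γ : Subgroup (SL2 (ZMod p))} {u : SL2 (ZMod p)}
    (hu : u ∈ Γ) (h1 : u ≠ 1) (ht : tr u = 2) : Group.IsSolvable Γ ∨ Γ = ⊤ := by
  obtain ⟨w, hw, huw⟩ := exists_mem_unip_of_tr_eq_two ht
  by_cases hΓ : Γ ≤ borel w
  · exact .inl (isSolvable_of_le hΓ (isSolvable_borel hw))
  obtain ⟨g, hg, hgw⟩ := SetLike.not_le_iff_exists.1 hΓ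
  right
  have hne := cross_mulVec_ne_zero hw hgw
  have hgw0 : g.1.mulVec w ≠ 0 := by
    intro h0
    rw [h0] at hne
    simp at hne
  exact eq_top_of_unip_le (sub_ne_zero.2 hne) (unip_le_of_mem hw h1 huw hu)
    (unip_le_of_mem hgw0 (u := g * u * g⁻¹) (by rwa [Ne, conj_eq_one_iff]) (conj_mem_unip huw)
      (Γ.mul_mem (Γ.mul_mem hg hu) (Γ.inv_mem hg)))

end ZModp

end SLTwo

namespace SLTwo

open Finset
open scoped Classical

section Numerics

lemma le_of_two_densities {w u₁ u₂ s₁ s₂ : ℝ} (f₁ : s₁ = 1 - u₁ ∨ s₁ = (1 - u₁) / 2)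
    (f₂ : s₂ = 1 - u₂ ∨ s₂ = (1 - u₂) / 2) (w₁ : 2 * w < u₁) (w₂ : 2 * w < u₂)
    (d₁ : u₁ = 1 / 2 ∨ u₁ = 1 / 3 ∨ u₁ = 1 / 4 ∨ u₁ = 1 / 5 ∨ u₁ ≤ 1 / 6)
    (d₂ : u₂ = 1 / 2 ∨ u₂ = 1 / 3 ∨ u₂ = 1 / 4 ∨ u₂ = 1 / 5 ∨ u₂ ≤ 1 / 6)
    (hw : 0 < w) (h : s₁ + s₂ = 1 - w) : 1 / 60 ≤ w := by
  rcases f₁ with rfl | rfl <;> rcases f₂ with rfl | rfl <;>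
    rcases d₁ with d₁ | d₁ | d₁ | d₁ | d₁ <;> rcases d₂ with d₂ | d₂ | d₂ | d₂ | d₂ <;>
    linarith

lemma le_of_three_densities {w u₁ u₂ u₃ s₁ s₂ s₃ : ℝ} (f₁ : s₁ = (1 - u₁) / 2)
    (f₂ : s₂ = (1 - u₂) / 2) (f₃ : s₃ = (1 - u₃) / 2) (w₁ : 2 * w < u₁) (w₂ : 2 * w < u₂)
    (w₃ : 2 * w < u₃)
    (d₁ : u₁ = 1 / 2 ∨ u₁ = 1 / 3 ∨ u₁ = 1 / 4 ∨ u₁ = 1 / 5 ∨ u₁ ≤ 1 / 6)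
    (d₂ : u₂ = 1 / 2 ∨ u₂ = 1 / 3 ∨ u₂ = 1 / 4 ∨ u₂ = 1 / 5 ∨ u₂ ≤ 1 / 6)
    (d₃ : u₃ = 1 / 2 ∨ u₃ = 1 / 3 ∨ u₃ = 1 / 4 ∨ u₃ = 1 / 5 ∨ u₃ ≤ 1 / 6)
    (hw : 0 < w) (h : s₁ + s₂ + s₃ = 1 - w) : 1 / 60 ≤ w := by
  have h' : u₁ + u₂ + u₃ = 1 + 2 * w := by linarith
  clear f₁ f₂ f₃ h
  rcases d₁ with rfl | rfl | rfl | rfl | d₁ <;> rcases d₂ with rfl | rfl | rfl | rfl | d₂ <;>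
    rcases d₃ with rfl | rfl | rfl | rfl | d₃ <;> linarith

end Numerics

section Counting

variable {G : Type*} [Group G]

/-- Noncentral commutation is transitive, and a noncentral element commutes with one of its
conjugates only when the two coincide or are mutually inverse. -/
structure IsTame (G : Type*) [Group G] : Prop where
  commute_trans : ∀ a b c : G, b ∉ Subgroup.center G → Commute a b → Commute b c → Commute a c
  conj_eq : ∀ x n : G, x ∉ Subgroup.center G → Commute (n * x * n⁻¹) x →
    n * x * n⁻¹ = x ∨ n * x * n⁻¹ = x⁻¹

lemma conj_mem_center_iff {x g : G} :
    g * x * g⁻¹ ∈ Subgroup.center G ↔ x ∈ Subgroup.center G := by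
  refine ⟨fun h ↦ ?_, fun h ↦ Subgroup.Normal.conj_mem inferInstance _ h _⟩
  simpa [mul_assoc] using Subgroup.Normal.conj_mem inferInstance _ h g⁻¹

lemma commute_conj_iff {x y g : G} :
    Commute (g * x * g⁻¹) (g * y * g⁻¹) ↔ Commute x y := by
  simp only [commute_iff_eq, conj_mul, mul_left_inj, mul_right_inj]

variable [Fintype G]

lemma card_filter_mem (H : Subgroup G) : #{y : G | y ∈ H} = Nat.card H := by
  rw [Nat.card_eq_fintype_card, ← Fintype.card_subtype]

/-- The noncentral elements commuting with some conjugate of `x`. -/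
noncomputable def commConj (x : G) : Finset G :=
  {y | y ∉ Subgroup.center G ∧ ∃ g, Commute y (g * x * g⁻¹)}

lemma mem_commConj {x y : G} :
    y ∈ commConj x ↔ y ∉ Subgroup.center G ∧ ∃ g, Commute y (g * x * g⁻¹) := by
  simp [commConj]

lemma IsTame.disjoint_commConj (hG : IsTame G) {x x' : G} (hx : x' ∉ Subgroup.center G)
    (h : x' ∉ commConj x) : Disjoint (commConj x) (commConj x') := by
  rw [Finset.disjoint_left]
  intro y hy hy'
  obtain ⟨hyc, g, hg⟩ := mem_commConj.1 hy
  obtain ⟨-, k, hk⟩ := mem_commConj.1 hy'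
  refine h (mem_commConj.2 ⟨hx, k⁻¹ * g, ?_⟩)
  rw [← commute_conj_iff (g := k)]
  have : k * (k⁻¹ * g * x * (k⁻¹ * g)⁻¹) * k⁻¹ = g * x * g⁻¹ := by group
  rw [this]
  exact hG.commute_trans _ _ _ hyc hk.symm hg

lemma card_conj_eq (x : G) :
    #{n : G | n * x * n⁻¹ = x} = Nat.card (Subgroup.centralizer {x}) := by
  rw [← card_filter_mem]
  congr 1
  ext n
  simp [Subgroup.mem_centralizer_singleton_iff, mul_inv_eq_iff_eq_mul]

lemma card_commute_eq (x : G) :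
    #{y : G | Commute y x} = Nat.card (Subgroup.centralizer {x}) := by
  rw [← card_filter_mem]
  congr 1
  ext n
  simp [Subgroup.mem_centralizer_singleton_iff, commute_iff_eq]

lemma card_commute_conj (x g : G) :
    #{y : G | Commute y (g * x * g⁻¹)} = Nat.card (Subgroup.centralizer {x}) := by
  rw [← card_commute_eq x]
  refine card_bij' (fun y _ ↦ g⁻¹ * y * g) (fun y _ ↦ g * y * g⁻¹) ?_ ?_ ?_ ?_
  · intro y hy
    simp only [mem_filter, mem_univ, true_and] at hy ⊢
    rw [← commute_conj_iff (g := g)]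
    simpa [mul_assoc] using hy
  · intro y hy
    simp only [mem_filter, mem_univ, true_and] at hy ⊢
    rwa [commute_conj_iff]
  · intros; group
  · intros; group

lemma IsTame.exists_card_commute_self (hG : IsTame G) {x : G} (hx : x ∉ Subgroup.center G) :
    ∃ f, (f = 1 ∨ f = 2) ∧
      #{n : G | Commute (n * x * n⁻¹) x} = f * Nat.card (Subgroup.centralizer {x}) := by
  by_cases h : ∃ m, m * x * m⁻¹ = x⁻¹ ∧ x⁻¹ ≠ x
  · obtain ⟨m, hm, hxx⟩ := h
    refine ⟨2, .inr rfl, ?_⟩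
    have e : ({n : G | Commute (n * x * n⁻¹) x} : Finset G) =
        ({n : G | n * x * n⁻¹ = x} : Finset G) ∪ ({n : G | n * x * n⁻¹ = x⁻¹} : Finset G) := by
      ext n
      simp only [mem_filter, mem_univ, true_and, mem_union]
      refine ⟨hG.conj_eq x n hx, ?_⟩
      rintro (e | e) <;> rw [e]
      exact (Commute.refl x).inv_left
    have e' : #{n : G | n * x * n⁻¹ = x⁻¹} = #{n : G | n * x * n⁻¹ = x} := by
      refine card_bij' (fun n _ ↦ m⁻¹ * n) (fun n _ ↦ m * n) ?_ ?_ ?_ ?_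
      · intro n hn
        simp only [mem_filter, mem_univ, true_and] at hn ⊢
        have : m⁻¹ * n * x * (m⁻¹ * n)⁻¹ = m⁻¹ * (n * x * n⁻¹) * m := by group
        rw [this, hn, ← hm]; group
      · intro n hn
        simp only [mem_filter, mem_univ, true_and] at hn ⊢
        have : m * n * x * (m * n)⁻¹ = m * (n * x * n⁻¹) * m⁻¹ := by group
        rw [this, hn, ← hm]
      · intros; group
      · intros; group
    rw [e, card_union_of_disjoint, e', card_conj_eq, two_mul]
    rw [Finset.disjoint_left]
    intro n h1 h2
    simp only [mem_filter, mem_univ, true_and] at h1 h2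
    exact hxx (h2.symm.trans h1)
  · refine ⟨1, .inl rfl, ?_⟩
    rw [one_mul, ← card_conj_eq]
    congr 1
    ext n
    simp only [mem_filter, mem_univ, true_and]
    refine ⟨fun hn ↦ ?_, fun hn ↦ by rw [hn]⟩
    rcases hG.conj_eq x n hx hn with e | e
    · exact e
    · by_contra h1
      exact h ⟨n, e, fun h2 ↦ h1 (e.trans h2)⟩

lemma IsTame.exists_card_commConj (hG : IsTame G) {x : G} (hx : x ∉ Subgroup.center G) :
    ∃ f, (f = 1 ∨ f = 2) ∧ Fintype.card G *
      (Nat.card (Subgroup.centralizer {x}) - Nat.card (Subgroup.center G)) =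
        #(commConj x) * (f * Nat.card (Subgroup.centralizer {x})) := by
  obtain ⟨f, hf, e⟩ := hG.exists_card_commute_self hx
  refine ⟨f, hf, ?_⟩
  refine card_mul_eq_card_mul (s := univ) (t := commConj x)
    (fun g y ↦ Commute y (g * x * g⁻¹)) ?_ ?_
  · intro g _
    rw [← card_commute_conj x g, ← card_filter_mem, ← card_sdiff_of_subset]
    · congr 1
      ext y
      simp only [bipartiteAbove, mem_filter, mem_univ, true_and, mem_sdiff, mem_commConj]
      exact ⟨fun h ↦ ⟨h.2, h.1.1⟩, fun h ↦ ⟨⟨h.2, g, h.1⟩, h.1⟩⟩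
    · intro y hy
      simp only [mem_filter, mem_univ, true_and] at hy ⊢
      exact ((Subgroup.mem_center_iff.1 hy) _).symm
  · intro y hy
    obtain ⟨hyc, g, hg⟩ := mem_commConj.1 hy
    rw [← e]
    refine card_bij' (fun n _ ↦ g⁻¹ * n) (fun n _ ↦ g * n) ?_ ?_ ?_ ?_
    · intro n hn
      simp only [bipartiteBelow, mem_filter, mem_univ, true_and] at hn ⊢
      rw [← commute_conj_iff (g := g)]
      have : g * (g⁻¹ * n * x * (g⁻¹ * n)⁻¹) * g⁻¹ = n * x * n⁻¹ := by group
      rw [this]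
      exact hG.commute_trans _ _ _ hyc hn.symm hg
    · intro n hn
      simp only [bipartiteBelow, mem_filter, mem_univ, true_and] at hn ⊢
      rw [← commute_conj_iff (g := g)] at hn
      have : g * n * x * (g * n)⁻¹ = g * (n * x * n⁻¹) * g⁻¹ := by group
      rw [this]
      exact hG.commute_trans _ _ _ (by rwa [conj_mem_center_iff]) hg hn.symm
    · intros; group
    · intros; group

lemma IsTame.isSolvable_of_card_le (hG : IsTame G) {x : G} (hx : x ∉ Subgroup.center G)
    (h : Fintype.card G ≤ 2 * Nat.card (Subgroup.centralizer {x})) : Group.IsSolvable G := by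
  have hc := (Subgroup.centralizer {x}).card_mul_index
  rw [Nat.card_eq_fintype_card (α := G)] at hc
  have hpos : 0 < Nat.card (Subgroup.centralizer {x}) := Nat.card_pos
  refine isSolvable_of_commute_subgroup (Subgroup.centralizer {x}) ?_ ?_
  · have hi : (Subgroup.centralizer {x}).index ≤ 2 := by
      rw [← hc, mul_comm 2] at h
      exact Nat.le_of_mul_le_mul_left h hpos
    have hi0 : (Subgroup.centralizer {x}).index ≠ 0 := Subgroup.index_ne_zero_of_finite
    obtain hi | hi : (Subgroup.centralizer {x}).index = 1 ∨
      (Subgroup.centralizer {x}).index = 2 := by omega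
    · rw [Subgroup.index_eq_one.1 hi]
      exact fun _ _ ↦ Subgroup.mem_top _
    · intro g h
      rw [Subgroup.mul_mem_iff_of_index_two hi, Subgroup.mul_mem_iff_of_index_two hi,
        Subgroup.mul_mem_iff_of_index_two hi, inv_mem_iff, inv_mem_iff]
      tauto
  · intro a ha b hb
    rw [Subgroup.mem_centralizer_singleton_iff] at ha hb
    exact hG.commute_trans _ _ _ hx ha hb.symm

lemma IsTame.exists_density (hG : IsTame G) (hs : ¬ Group.IsSolvable G) {x : G}
    (hx : x ∉ Subgroup.center G) : ∃ u s : ℝ,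
      (#(commConj x) : ℝ) = s * Fintype.card G ∧ (s = 1 - u ∨ s = (1 - u) / 2) ∧
      2 * (Nat.card (Subgroup.center G) / Fintype.card G : ℝ) < u ∧
      (u = 1 / 2 ∨ u = 1 / 3 ∨ u = 1 / 4 ∨ u = 1 / 5 ∨ u ≤ 1 / 6) := by
  obtain ⟨f, hf, e⟩ := hG.exists_card_commConj hx
  have hlt : ¬ _ := fun h ↦ hs (hG.isSolvable_of_card_le hx h)
  rw [not_le] at hlt
  obtain ⟨t, ht⟩ := Subgroup.card_dvd_of_le (Subgroup.center_le_centralizer {x})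
  have hz : 0 < Nat.card (Subgroup.center G) := Nat.card_pos
  have hn : 0 < Fintype.card G := Fintype.card_pos
  have ht0 : t ≠ 0 := by rintro rfl; simp at ht
  have ht1 : t ≠ 1 := by
    rintro rfl
    rw [mul_one] at ht
    have := Subgroup.eq_of_le_of_card_ge (Subgroup.center_le_centralizer {x}) ht.le
    apply hx
    rw [this, Subgroup.mem_centralizer_singleton_iff]
  rw [ht] at e hlt
  set z := Nat.card (Subgroup.center G)
  set n := Fintype.card G
  have ht2 : 2 ≤ t := by omega
  have hzR : (0 : ℝ) < z := by exact_mod_cast hz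
  have hnR : (0 : ℝ) < n := by exact_mod_cast hn
  have htR : (0 : ℝ) < t := by exact_mod_cast (by omega : 0 < t)
  have e' : (n : ℝ) * (z * t - z) = #(commConj x) * (f * (z * t)) := by
    have := congr_arg (Nat.cast (R := ℝ)) e
    rw [Nat.cast_mul, Nat.cast_sub (Nat.le_mul_of_pos_right _ (by omega))] at this
    push_cast at this
    exact this
  have e2 : (n : ℝ) * (t - 1) = #(commConj x) * (f * t) := by
    apply mul_left_cancel₀ hzR.ne'
    linear_combination e'
  refine ⟨1 / t, #(commConj x) / n, ?_, ?_, ?_, ?_⟩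
  · field_simp
  · rcases hf with rfl | rfl
    · left
      push_cast at e2
      field_simp
      linear_combination -e2
    · right
      push_cast at e2
      field_simp
      linear_combination -e2
  · have : (2 * (z * t) : ℝ) < n := by exact_mod_cast hlt
    rw [lt_div_iff₀ htR, ← mul_div_assoc, div_mul_eq_mul_div, div_lt_one hnR]
    linarith
  · rcases lt_or_ge t 6 with h6 | h6
    · interval_cases t <;> simp
    · right; right; right; right
      have : (6 : ℝ) ≤ t := by exact_mod_cast h6
      exact one_div_le_one_div_of_le (by norm_num) this

/-- A finite tame group is solvable or has at most `60` elements modulo its center. -/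
theorem IsTame.isSolvable_or_card_le (hG : IsTame G) :
    Group.IsSolvable G ∨ Fintype.card G ≤ 60 * Nat.card (Subgroup.center G) := by
  rw [or_iff_not_imp_left]
  intro hs
  have hz : 0 < Nat.card (Subgroup.center G) := Nat.card_pos
  have hn : 0 < Fintype.card G := Fintype.card_pos
  set P : Finset G := {y | y ∉ Subgroup.center G} with hP
  have hPc : #P + Nat.card (Subgroup.center G) = Fintype.card G := by
    rw [← card_filter_mem, add_comm, ← card_univ]
    convert card_filter_add_card_filter_not (s := univ) (fun y : G ↦ y ∈ Subgroup.center G)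
  have hsub : ∀ x, commConj x ⊆ P := fun x y hy ↦ by
    simpa [hP] using (mem_commConj.1 hy).1
  have mem_P : ∀ {x}, x ∈ P → x ∉ Subgroup.center G := by simp [hP]
  obtain ⟨w, hw⟩ : ∃ w : ℝ, w = Nat.card (Subgroup.center G) / Fintype.card G := ⟨_, rfl⟩
  have hnR : (0 : ℝ) < Fintype.card G := by exact_mod_cast hn
  have hw0 : 0 < w := by rw [hw]; positivity
  have hPw : (#P : ℝ) = (1 - w) * Fintype.card G := by
    rw [hw, ← hPc]
    rw [← hPc] at hnR
    push_cast at hnR ⊢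
    field_simp
    ring
  suffices 1 / 60 ≤ w by
    rw [hw, le_div_iff₀ hnR] at this
    have : (Fintype.card G : ℝ) ≤ 60 * Nat.card (Subgroup.center G) := by linarith
    exact_mod_cast this
  have cancel : ∀ {a b : ℝ}, a * Fintype.card G ≤ b * Fintype.card G → a ≤ b :=
    fun h ↦ le_of_mul_le_mul_right h hnR
  obtain ⟨x₁, h₁⟩ : P.Nonempty := by
    by_contra hne
    rw [not_nonempty_iff_eq_empty] at hne
    refine hs (Group.isSolvable_of_comm fun a b ↦ ?_)
    have : b ∈ Subgroup.center G := by
      by_contra hb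
      have : b ∈ P := by simpa [hP] using hb
      simp [hne] at this
    exact Subgroup.mem_center_iff.1 this a
  obtain ⟨u₁, s₁, c₁, f₁, w₁, d₁⟩ := hG.exists_density hs (mem_P h₁)
  rw [← hw] at w₁
  by_cases k₁ : P ⊆ commConj x₁
  · have := card_le_card k₁
    rw [← Nat.cast_le (α := ℝ), hPw, c₁] at this
    have := cancel this
    have h' : #P = #(commConj x₁) := le_antisymm (card_le_card k₁) (card_le_card (hsub _))
    rw [← @Nat.cast_inj ℝ, hPw, c₁] at h'
    have := cancel h'.le
    have := cancel h'.ge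
    rcases f₁ with f₁ | f₁ <;> linarith
  obtain ⟨x₂, h₂, n₂⟩ := not_subset.1 k₁
  obtain ⟨u₂, s₂, c₂, f₂, w₂, d₂⟩ := hG.exists_density hs (mem_P h₂)
  rw [← hw] at w₂
  have dis₂ := hG.disjoint_commConj (mem_P h₂) n₂
  have cu₂ : (#(commConj x₁ ∪ commConj x₂) : ℝ) = (s₁ + s₂) * Fintype.card G := by
    rw [card_union_of_disjoint dis₂, Nat.cast_add, c₁, c₂, add_mul]
  have sub₂ := union_subset (hsub x₁) (hsub x₂)
  by_cases k₂ : P ⊆ commConj x₁ ∪ commConj x₂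
  · have h' := le_antisymm (card_le_card k₂) (card_le_card sub₂)
    rw [← @Nat.cast_inj ℝ, hPw, cu₂] at h'
    have g1 := cancel h'.le
    have g2 := cancel h'.ge
    exact le_of_two_densities f₁ f₂ w₁ w₂ d₁ d₂ hw0 (le_antisymm g2 g1)
  obtain ⟨x₃, h₃, n₃⟩ := not_subset.1 k₂
  rw [mem_union, not_or] at n₃
  obtain ⟨u₃, s₃, c₃, f₃, w₃, d₃⟩ := hG.exists_density hs (mem_P h₃)
  rw [← hw] at w₃
  have dis₃ : Disjoint (commConj x₁ ∪ commConj x₂) (commConj x₃) := disjoint_union_left.2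
    ⟨hG.disjoint_commConj (mem_P h₃) n₃.1, hG.disjoint_commConj (mem_P h₃) n₃.2⟩
  have cu₃ : (#(commConj x₁ ∪ commConj x₂ ∪ commConj x₃) : ℝ) =
      (s₁ + s₂ + s₃) * Fintype.card G := by
    rw [card_union_of_disjoint dis₃, Nat.cast_add, cu₂, c₃, ← add_mul]
  have sub₃ := union_subset sub₂ (hsub x₃)
  have q : ∀ {u s : ℝ}, (s = 1 - u ∨ s = (1 - u) / 2) →
      (u = 1 / 2 ∨ u = 1 / 3 ∨ u = 1 / 4 ∨ u = 1 / 5 ∨ u ≤ 1 / 6) →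
      1 / 4 ≤ s ∧ (s = (1 - u) / 2 ∨ 1 / 2 ≤ s) := by
    rintro u s (rfl | rfl) (h | h | h | h | h) <;> constructor <;>
      first | linarith | (right; linarith) | (left; rfl)
  obtain ⟨q₁, r₁⟩ := q f₁ d₁
  obtain ⟨q₂, r₂⟩ := q f₂ d₂
  obtain ⟨q₃, r₃⟩ := q f₃ d₃
  by_cases k₃ : P ⊆ commConj x₁ ∪ commConj x₂ ∪ commConj x₃
  · have h' := le_antisymm (card_le_card k₃) (card_le_card sub₃)
    rw [← @Nat.cast_inj ℝ, hPw, cu₃] at h'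
    have g1 := cancel h'.le
    have g2 := cancel h'.ge
    rcases r₁ with r₁ | r₁
    swap; · linarith
    rcases r₂ with r₂ | r₂
    swap; · linarith
    rcases r₃ with r₃ | r₃
    swap; · linarith
    exact le_of_three_densities r₁ r₂ r₃ w₁ w₂ w₃ d₁ d₂ d₃ hw0 (le_antisymm g2 g1)
  obtain ⟨x₄, h₄, n₄⟩ := not_subset.1 k₃
  simp only [mem_union, not_or] at n₄
  obtain ⟨u₄, s₄, c₄, f₄, w₄, d₄⟩ := hG.exists_density hs (mem_P h₄)
  obtain ⟨q₄, -⟩ := q f₄ d₄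
  have dis₄ : Disjoint (commConj x₁ ∪ commConj x₂ ∪ commConj x₃) (commConj x₄) :=
    disjoint_union_left.2 ⟨disjoint_union_left.2 ⟨hG.disjoint_commConj (mem_P h₄) n₄.1.1,
      hG.disjoint_commConj (mem_P h₄) n₄.1.2⟩, hG.disjoint_commConj (mem_P h₄) n₄.2⟩
  have := card_le_card (union_subset sub₃ (hsub x₄))
  rw [card_union_of_disjoint dis₄, ← Nat.cast_le (α := ℝ), Nat.cast_add, cu₃, c₄, hPw,
    ← add_mul] at this
  have := cancel this
  linarith

end Counting

end SLTwo

namespace SLTwo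

section Trichotomy

variable {F : Type*} [Field F]

lemma isScalar_mem_center {Γ : Subgroup (SL2 F)} {x : Γ} (h : IsScalar x.1) :
    x ∈ Subgroup.center Γ := by
  rw [Subgroup.mem_center_iff]
  intro g
  apply Subtype.ext
  rcases eq_one_or_eq_neg_one_of_isScalar h with e | e <;> simp [e]

lemma tr_ne_of_not_isScalar (h2 : (2 : F) ≠ 0) {Γ : Subgroup (SL2 F)}
    (hΓ : ∀ u ∈ Γ, tr u = 2 → u = 1) {g : SL2 F} (hg : g ∈ Γ) (hs : ¬ IsScalar g) : tr g ≠ 2 ∧ tr g ≠ -2 := by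
  have h1 : IsScalar (1 : SL2 F) := by simp [IsScalar]
  refine ⟨fun h ↦ hs (hΓ g hg h ▸ h1), fun h ↦ ?_⟩
  have hd := det_eq g
  have e : g * g = 1 := by
    refine hΓ _ (Γ.mul_mem hg hg) ?_
    simp only [tr, mul_entry] at h ⊢
    grind
  rw [eq_iff_entries] at e
  obtain ⟨e1, e2, e3, e4⟩ := e
  simp [mul_entry] at e1 e2 e3 e4
  rw [tr] at h
  refine hs ⟨?_, ?_, ?_⟩ <;> apply mul_left_cancel₀ h2 <;> grind

lemma isSolvable_or_card_le [Fintype F] [DecidableEq F] (h2 : (2 : F) ≠ 0) {Γ : Subgroup (SL2 F)}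
    (hΓ : ∀ u ∈ Γ, tr u = 2 → u = 1) : Group.IsSolvable Γ ∨ Nat.card Γ ≤ 120 := by
  classical
  by_cases hc : ∃ x : Γ, x ∈ Subgroup.center Γ ∧ ¬ IsScalar x.1
  · obtain ⟨x, hx, hs⟩ := hc
    rw [Subgroup.mem_center_iff] at hx
    refine .inl (Group.isSolvable_of_comm fun a b ↦ Subtype.ext ?_)
    exact commute_trans hs (congr_arg Subtype.val (hx a)) (congr_arg Subtype.val (hx b).symm)
  push Not at hc
  have hns : ∀ {x : Γ}, x ∉ Subgroup.center Γ → ¬ IsScalar x.1 :=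
    fun h hs ↦ h (isScalar_mem_center hs)
  have tame : IsTame Γ := by
    refine ⟨fun a b c hb hab hbc ↦ ?_, fun x n hx h ↦ ?_⟩
    · exact Subtype.ext (commute_trans (hns hb) (congr_arg Subtype.val hab)
        (congr_arg Subtype.val hbc))
    · obtain ⟨t1, t2⟩ := tr_ne_of_not_isScalar h2 hΓ x.2 (hns hx)
      rcases eq_or_eq_inv_of_commute (l := n.1 * x.1 * n.1⁻¹) h2 t1 t2 (Commute.refl x.1)
        (congr_arg Subtype.val h) (tr_conj _ _) with e | e
      · exact .inl (Subtype.ext e)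
      · exact .inr (Subtype.ext e)
  refine tame.isSolvable_or_card_le.imp id fun h ↦ ?_
  have hcard : Nat.card (Subgroup.center Γ) ≤ 2 := by
    have : Nat.card (Subgroup.center Γ) ≤ Nat.card ({1, -1} : Finset (SL2 F)) := by
      refine Nat.card_le_card_of_injective (fun x ↦ ⟨x.1.1, ?_⟩) ?_
      · simpa using eq_one_or_eq_neg_one_of_isScalar (hc x.1 x.2)
      · intro x y e
        exact Subtype.ext (Subtype.ext (Subtype.mk.inj e))
    rw [Nat.card_eq_fintype_card (α := ({1, -1} : Finset (SL2 F))), Fintype.card_coe] at this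
    exact this.trans Finset.card_le_two
  rw [Nat.card_eq_fintype_card]
  omega

/-- A subgroup of `SL₂(𝔽_p)` is solvable, or has at most `120` elements, or is everything. -/
theorem isSolvable_or_card_le_or_eq_top {p : ℕ} [Fact p.Prime] (h2 : (2 : ZMod p) ≠ 0)
    (Γ : Subgroup (SL2 (ZMod p))) : Group.IsSolvable Γ ∨ Nat.card Γ ≤ 120 ∨ Γ = ⊤ := by
  by_cases h : ∃ u ∈ Γ, tr u = 2 ∧ u ≠ 1
  · obtain ⟨u, hu, ht, h1⟩ := h
    exact (isSolvable_or_eq_top_of_tr_eq_two hu h1 ht).imp id .inr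
  · push Not at h
    exact (isSolvable_or_card_le h2 h).imp id .inl

end Trichotomy

section SmallDoubling

open Finset

variable {G : Type*} [Group G] [DecidableEq G]

lemma exists_small_tripling {A : Finset G} (hA : A.Nonempty) {k : ℕ} (h : #(A * A) ≤ k * #A) :
    ∃ X ⊆ A, X.Nonempty ∧ #A ≤ k * #X ∧ #(X ^ 3) ≤ k ^ 2 * #X := by
  obtain ⟨X, hX, hmin⟩ := exists_min_image (A.powerset.filter Finset.Nonempty)
    (fun X ↦ (#(X * A) / #X : ℚ)) ⟨A, by simpa using hA⟩
  simp only [mem_filter, mem_powerset, and_imp] at hX hmin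
  obtain ⟨hXA, hXn⟩ := hX
  have hmin' : ∀ Y ⊆ A, #(X * A) * #Y ≤ #(Y * A) * #X := by
    intro Y hY
    rcases Y.eq_empty_or_nonempty with rfl | hYn
    · simp
    have := hmin Y hY hYn
    rw [div_le_div_iff₀ (by exact_mod_cast hXn.card_pos) (by exact_mod_cast hYn.card_pos)] at this
    exact_mod_cast this
  have hXk : #(X * A) ≤ k * #X := by
    refine Nat.le_of_mul_le_mul_right ?_ hA.card_pos
    calc #(X * A) * #A ≤ #(A * A) * #X := hmin' A Subset.rfl
      _ ≤ k * #A * #X := by gcongr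
      _ = k * #X * #A := by ring
  refine ⟨X, hXA, hXn, (card_le_card_mul_left hXn).trans hXk, ?_⟩
  refine Nat.le_of_mul_le_mul_right ?_ hXn.card_pos
  calc #(X ^ 3) * #X ≤ #(X * X * A) * #X := by
        rw [pow_succ, sq]
        gcongr
    _ ≤ #(X * A) * #(X * X) :=
        pluennecke_petridis_inequality_mul X fun Y hY ↦ hmin' Y (hY.trans hXA)
    _ ≤ #(X * A) * #(X * A) := by gcongr
    _ ≤ k * #X * (k * #X) := by gcongr
    _ = k ^ 2 * #X * #X := by ring

lemma card_mul_mul_le {X : Finset G} {k : ℕ} (h : #(X ^ 3) ≤ k ^ 2 * #X) {Y₁ Y₂ Y₃ : Finset G}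
    (h₁ : Y₁ = X ∨ Y₁ = X⁻¹) (h₂ : Y₂ = X ∨ Y₂ = X⁻¹) (h₃ : Y₃ = X ∨ Y₃ = X⁻¹) :
    #(Y₁ * Y₂ * Y₃) ≤ k ^ 6 * #X := by
  have key : ∀ {Y : Finset G}, Y = X ∨ Y = X⁻¹ → ∃ e : ℤ, |e| = 1 ∧ Y = X ^ e := by
    rintro Y (rfl | rfl)
    · exact ⟨1, by simp, by simp⟩
    · exact ⟨-1, by simp, by simp⟩
  obtain ⟨e₁, a₁, rfl⟩ := key h₁
  obtain ⟨e₂, a₂, rfl⟩ := key h₂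
  obtain ⟨e₃, a₃, rfl⟩ := key h₃
  have := small_alternating_pow_of_small_tripling (K := k ^ 2) (A := X) le_rfl
    (by exact_mod_cast h) ![e₁, e₂, e₃] (by simp [Fin.forall_fin_succ, a₁, a₂, a₃])
  simp only [List.finRange_succ, List.finRange_zero, List.map_nil, List.map_cons, List.prod_cons,
    List.prod_nil, mul_one, ← mul_assoc, ← pow_mul] at this
  exact_mod_cast this

lemma card_union_inv_pow_three_le {X : Finset G} (hX : X.Nonempty) {k : ℕ} (hk : 2 ≤ k)
    (h : #(X ^ 3) ≤ k ^ 2 * #X) : #((X ∪ X⁻¹ ∪ 1) ^ 3) ≤ k ^ 11 * #X := by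
  have union_le : ∀ {U V : Finset G} {a b : ℕ}, #U ≤ a → #V ≤ b → #(U ∪ V) ≤ a + b :=
    fun hU hV ↦ (card_union_le _ _).trans (add_le_add hU hV)
  obtain ⟨S, hS⟩ : ∃ S, S = X ∪ X⁻¹ := ⟨_, rfl⟩
  have hSn : S.Nonempty := by rw [hS]; exact hX.mono subset_union_left
  have hS3 : #(S ^ 3) ≤ 8 * (k ^ 6 * #X) := by
    have t {Y₁ Y₂ Y₃ : Finset G} := card_mul_mul_le (Y₁ := Y₁) (Y₂ := Y₂) (Y₃ := Y₃) h
    have l : X = X ∨ X = X⁻¹ := .inl rfl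
    have r : X⁻¹ = X ∨ X⁻¹ = X⁻¹ := .inr rfl
    have e : S ^ 3 = ((X * X * X ∪ X⁻¹ * X * X) ∪ (X * X⁻¹ * X ∪ X⁻¹ * X⁻¹ * X)) ∪
        ((X * X * X⁻¹ ∪ X⁻¹ * X * X⁻¹) ∪ (X * X⁻¹ * X⁻¹ ∪ X⁻¹ * X⁻¹ * X⁻¹)) := by
      rw [hS, pow_succ, sq]
      simp only [union_mul, mul_union]
    rw [e]
    refine (union_le (union_le (union_le (t l l l) (t r l l)) (union_le (t l r l) (t r r l)))
      (union_le (union_le (t l l r) (t r l r)) (union_le (t l r r) (t r r r)))).trans ?_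
    linarith
  have hsub : (S ∪ 1) ^ 3 ⊆ (S ^ 3 ∪ S ^ 2) ∪ (S ^ 1 ∪ S ^ 0) := by
    intro x
    simp only [pow_succ, pow_zero, union_mul, mul_union, one_mul, mul_one, mem_union]
    tauto
  have mono : ∀ n, n ≤ 3 → #(S ^ n) ≤ 8 * (k ^ 6 * #X) := fun n hn ↦
    (hSn.card_pow_mono hn).trans hS3
  rw [← hS]
  calc #((S ∪ 1) ^ 3) ≤ _ := card_le_card hsub
    _ ≤ _ := union_le (union_le hS3 (mono 2 (by norm_num)))
        (union_le (mono 1 (by norm_num)) (mono 0 (by norm_num)))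
    _ = 2 ^ 5 * (k ^ 6 * #X) := by ring
    _ ≤ k ^ 5 * (k ^ 6 * #X) := by gcongr
    _ = k ^ 11 * #X := by ring

end SmallDoubling

section Main

open Finset

lemma isSolvable_zpowers {G : Type*} [Group G] (g : G) : Group.IsSolvable (Subgroup.zpowers g) :=
  Group.isSolvable_of_comm fun a b ↦ Subtype.ext
    (Subgroup.mem_zpowers_iff.1 a.2 |>.elim fun m hm ↦ Subgroup.mem_zpowers_iff.1 b.2 |>.elim
      fun n hn ↦ by simp [← hm, ← hn, zpow_mul_comm])

set_option exponentiation.threshold 500 in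
theorem exists_solvable_of_card_mul_le {p : ℕ} [Fact p.Prime] {k : ℕ} (hk : 2 ≤ k)
    {A : Finset (SL2 (ZMod p))} (hA : A.Nonempty) (h : #(A * A) ≤ k * #A) :
    Nat.card (SL2 (ZMod p)) ≤ k ^ 500 * #A ∨
      ∃ A' ⊆ A, #A ≤ k ^ 500 * #A' ∧
        ∃ H : Subgroup (SL2 (ZMod p)), Group.IsSolvable H ∧ (A' : Set (SL2 (ZMod p))) ⊆ H := by
  have mono : ∀ {m : ℕ}, m ≤ 500 → k ^ m ≤ k ^ 500 :=
    fun hm ↦ Nat.pow_le_pow_right (by omega) hm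
  by_cases h2 : (2 : ZMod p) = 0
  · left
    have hp : p = 2 := by
      have : ((2 : ℕ) : ZMod p) = 0 := by exact_mod_cast h2
      rw [ZMod.natCast_eq_zero_iff] at this
      exact (Nat.prime_dvd_prime_iff_eq Fact.out Nat.prime_two).1 this
    subst hp
    calc Nat.card (SL2 (ZMod 2)) ≤ Nat.card (Matrix (Fin 2) (Fin 2) (ZMod 2)) :=
          Nat.card_le_card_of_injective Subtype.val Subtype.val_injective
      _ = 2 ^ 4 := by simp [Matrix]
      _ ≤ k ^ 4 := by gcongr
      _ ≤ k ^ 500 := mono (by norm_num)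
      _ ≤ k ^ 500 * #A := Nat.le_mul_of_pos_right _ hA.card_pos
  obtain ⟨X, hXA, hXn, hAX, hX3⟩ := exists_small_tripling hA h
  have small : ∀ {m : ℕ}, m + 1 ≤ 500 → #X ≤ k ^ m → ∃ A' ⊆ A, #A ≤ k ^ 500 * #A' ∧
      ∃ H : Subgroup (SL2 (ZMod p)), Group.IsSolvable H ∧ (A' : Set (SL2 (ZMod p))) ⊆ H := by
    intro m hm hX
    obtain ⟨a, ha⟩ := hA
    refine ⟨{a}, by simpa using ha, ?_, Subgroup.zpowers a, isSolvable_zpowers a, by simp⟩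
    calc #A ≤ k * #X := hAX
      _ ≤ k * k ^ m := by gcongr
      _ = k ^ (m + 1) := (pow_succ' k m).symm
      _ ≤ k ^ 500 := mono hm
      _ = k ^ 500 * #{a} := by simp
  by_cases hs : Group.IsSolvable (Subgroup.closure (X : Set (SL2 (ZMod p))))
  · refine .inr ⟨X, hXA, hAX.trans ?_, _, hs, Subgroup.subset_closure⟩
    gcongr
    exact (pow_one k).symm.le.trans (mono (by norm_num))
  rcases (isSolvable_or_card_le_or_eq_top h2 _).resolve_left hs with hc | htop
  · refine .inr (small (m := 7) (by norm_num) ?_)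
    calc #X = Nat.card (X : Set (SL2 (ZMod p))) := by simp
      _ ≤ Nat.card (Subgroup.closure (X : Set (SL2 (ZMod p)))) :=
        Nat.card_mono (Set.toFinite _) Subgroup.subset_closure
      _ ≤ 120 := hc
      _ ≤ 2 ^ 7 := by norm_num
      _ ≤ k ^ 7 := by gcongr
  obtain ⟨B, hB⟩ : ∃ B, B = X ∪ X⁻¹ ∪ 1 := ⟨_, rfl⟩
  have hXB : X ⊆ B := by rw [hB]; exact subset_union_left.trans subset_union_left
  have hinv : B⁻¹ = B := by
    ext x
    simp [hB, or_left_comm]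
  have hB3 : #(B ^ 3) ≤ k ^ 11 * #B := by
    refine (hB ▸ card_union_inv_pow_three_le hXn hk hX3).trans ?_
    gcongr
  have slow : IsSlow B (k ^ 11) := by
    refine ⟨hk.trans (Nat.le_self_pow (by norm_num) k), by simp [hB], hinv, fun m hm ↦ ?_,
      fun w hw ↦ ?_⟩
    · have := small_pow_of_small_tripling (K := (k ^ 11 : ℕ)) (A := B) hm
        (by exact_mod_cast hB3) hinv
      exact_mod_cast this
    · by_contra! hall
      refine hs (isSolvable_of_le ?_ (isSolvable_borel hw))
      rw [Subgroup.closure_le]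
      exact fun x hx ↦ hall x (hXB hx)
  by_cases hsize : (k ^ 11) ^ 44 < #B
  · left
    have hgen : Submonoid.closure (B : Set (SL2 (ZMod p))) = ⊤ := by
      rw [eq_top_iff, ← Subgroup.top_toSubmonoid, ← htop, Subgroup.closure_toSubmonoid]
      apply Submonoid.closure_mono
      rw [hB]
      push_cast
      exact Set.subset_union_left
    calc Nat.card (SL2 (ZMod p)) = Fintype.card (SL2 (ZMod p)) := Nat.card_eq_fintype_card
      _ ≤ (k ^ 11) ^ 23 * #B := slow.card_le h2 hgen hsize
      _ ≤ (k ^ 11) ^ 23 * (2 ^ 2 * #A) := by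
        gcongr
        have h1 : #B ≤ #X + #X + 1 := by
          rw [hB]
          refine (card_union_le _ _).trans (add_le_add ((card_union_le _ _).trans ?_) ?_) <;> simp
        have := card_le_card hXA
        have := hXn.card_pos
        omega
      _ ≤ (k ^ 11) ^ 23 * (k ^ 2 * #A) := by gcongr
      _ = k ^ 255 * #A := by rw [← mul_assoc, ← pow_mul, ← pow_add]
      _ ≤ k ^ 500 * #A := Nat.mul_le_mul_right _ (mono (by norm_num))
  · rw [not_lt, ← pow_mul] at hsize
    exact .inr (small (m := 11 * 44) (by norm_num) ((card_le_card hXB).trans hsize))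

end Main

end SLTwo

/-- Helfgott's theorem: a finite subset of `SL₂(𝔽_p)` with doubling at most `K` either has
size at least `K^{-C}|SL₂(𝔽_p)|` or has a proportion `≥ K^{-C}` subset contained in a
solvable subgroup. -/
theorem helfgott_theorem :
    ∃ C : ℝ, 1 ≤ C ∧
      ∀ p : ℕ, p.Prime → ∀ K : ℝ, 2 ≤ K →
        ∀ A : Set (Matrix.SpecialLinearGroup (Fin 2) (ZMod p)), A.Finite → A.Nonempty →
          ((A * A).ncard : ℝ) ≤ K * A.ncard →
          (K ^ (-C) * (Nat.card (Matrix.SpecialLinearGroup (Fin 2) (ZMod p)) : ℝ)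
              ≤ A.ncard) ∨
          ∃ A' ⊆ A, K ^ (-C) * A.ncard ≤ (A'.ncard : ℝ) ∧
            ∃ H : Subgroup (Matrix.SpecialLinearGroup (Fin 2) (ZMod p)),
              IsSolvable H ∧ A' ⊆ (H : Set _) := by
  refine ⟨1000, by norm_num, fun p hp K hK A hfin hne hcard ↦ ?_⟩
  have : Fact p.Prime := ⟨hp⟩
  classical
  obtain ⟨B, rfl⟩ := hfin.exists_finset_coe
  have hK0 : (0 : ℝ) < K := by linarith
  rw [← Finset.coe_mul, Set.ncard_coe_finset, Set.ncard_coe_finset] at hcard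
  have hk2 : 2 ≤ ⌈K⌉₊ := by exact_mod_cast hK.trans (Nat.le_ceil K)
  have hkK : ((⌈K⌉₊ : ℕ) : ℝ) ^ 500 ≤ K ^ (1000 : ℝ) := by
    have h1 : ((⌈K⌉₊ : ℕ) : ℝ) ≤ K ^ 2 := by nlinarith [Nat.ceil_lt_add_one hK0.le]
    calc ((⌈K⌉₊ : ℕ) : ℝ) ^ 500 ≤ (K ^ 2) ^ 500 := pow_le_pow_left₀ (Nat.cast_nonneg _) h1 _
      _ = K ^ (1000 : ℝ) := by rw [← pow_mul, ← Real.rpow_natCast]; norm_num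
  have hB : (B * B).card ≤ ⌈K⌉₊ * B.card := by
    have : ((B * B).card : ℝ) ≤ ⌈K⌉₊ * B.card :=
      hcard.trans (mul_le_mul_of_nonneg_right (Nat.le_ceil K) (Nat.cast_nonneg _))
    exact_mod_cast this
  have bound : ∀ {m n : ℕ}, m ≤ ⌈K⌉₊ ^ 500 * n → K ^ (-1000 : ℝ) * (m : ℝ) ≤ n := by
    intro m n h
    rw [Real.rpow_neg hK0.le, inv_mul_le_iff₀ (Real.rpow_pos_of_pos hK0 _)]
    calc (m : ℝ) ≤ (⌈K⌉₊ : ℝ) ^ 500 * n := by exact_mod_cast h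
      _ ≤ K ^ (1000 : ℝ) * n := mul_le_mul_of_nonneg_right hkK (Nat.cast_nonneg _)
  rcases SLTwo.exists_solvable_of_card_mul_le hk2 (by simpa using hne) hB with
    h | ⟨A', hA', h, H, hH, hsub⟩
  · left
    rw [Set.ncard_coe_finset]
    exact bound h
  · refine .inr ⟨A', by exact_mod_cast hA', ?_, H, hH, hsub⟩
    rw [Set.ncard_coe_finset, Set.ncard_coe_finset]
    exact bound h
end

section
/- For every real ε > 0 and every real K ≥ 1 there exists a constant c = c(ε, K) > 0 such that the following holds (the Freiman–Bilu lemma). Let d be a positive integer and let A be a finite nonempty subset of ℝ^d with |A + A| ≤ K·|A|. Then there exist a subset A′ ⊆ A with |A′| ≥ c·|A| and an affine subspace W of ℝ^d whose dimension is at most log₂ K + ε such that A′ ⊆ W. (In particular, the dimension bound is independent of d.) -/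
open Pointwise

open Finset in
open scoped Classical in
/-- A large finite set of doubling at most `K` has a long arithmetic progression based at `0`
in its difference set. -/
theorem exists_ne_zero_forall_nsmul_mem_sub {G : Type*} [AddCommGroup G] {A : Finset G} {K : ℝ}
    (hK : 1 ≤ K) (hA : (#(A + A) : ℝ) ≤ K * #A) (L : ℕ)
    (hcard : (K ^ (L + 1)) ^ (L + 1) < #A) :
    ∃ v : G, v ≠ 0 ∧ ∀ j ≤ L, j • v ∈ A - A := by
  have hpos : (0 : ℝ) < #A := lt_of_le_of_lt (by positivity) hcard
  have hne : A.Nonempty := by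
    rw [← card_pos]; exact_mod_cast hpos
  have hS : ∀ j : Fin (L + 1), ∃ S : Finset G, (#S : ℝ) ≤ K ^ (L + 1) * #A ∧
      ∀ a ∈ A, ∀ b ∈ A, (j : ℕ) • a + b ∈ S := by
    intro j
    have h := pluennecke_ruzsa_inequality_nsmul_add hne A ((j : ℕ) + 1)
    rw [succ_nsmul] at h
    refine ⟨_, (NNRat.cast_le (K := ℝ).2 h).trans ?_,
      fun a ha b hb ↦ add_mem_add (nsmul_mem_nsmul ha) hb⟩
    push_cast
    gcongr
    calc ((#(A + A) : ℝ) / #A) ^ ((j : ℕ) + 1) ≤ K ^ ((j : ℕ) + 1) := by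
          gcongr
          rwa [div_le_iff₀ hpos]
      _ ≤ K ^ (L + 1) := pow_le_pow_right₀ hK (by omega)
  choose S hScard hSmem using hS
  let f : G × (Fin (L + 1) → G) → (Fin (L + 1) → G) := fun p j ↦ (j : ℕ) • p.1 + p.2 j
  have hlt : #(Fintype.piFinset S) < #(A ×ˢ Fintype.piFinset fun _ : Fin (L + 1) ↦ A) := by
    rw [card_product, Fintype.card_piFinset, Fintype.card_piFinset]
    have : (∏ j, (#(S j) : ℝ)) < #A * ∏ _j : Fin (L + 1), (#A : ℝ) := by
      calc (∏ j, (#(S j) : ℝ)) ≤ ∏ _j : Fin (L + 1), (K ^ (L + 1) * #A) :=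
            prod_le_prod (fun _ _ ↦ by positivity) fun j _ ↦ hScard j
        _ = (K ^ (L + 1)) ^ (L + 1) * ∏ _j : Fin (L + 1), (#A : ℝ) := by
            rw [prod_mul_distrib]; simp
        _ < _ := by gcongr
    exact_mod_cast this
  obtain ⟨⟨a, b⟩, hab, ⟨a', b'⟩, hab', hne', heq⟩ :=
    exists_ne_map_eq_of_card_lt_of_maps_to (f := f) hlt (by
      rintro ⟨a, b⟩ hab
      simp only [coe_product, Set.mem_prod, mem_coe, Fintype.mem_piFinset] at hab ⊢
      exact fun j ↦ hSmem j a hab.1 _ (hab.2 j))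
  simp only [mem_product, Fintype.mem_piFinset] at hab hab'
  refine ⟨a - a', ?_, fun j hj ↦ ?_⟩
  · intro h
    obtain rfl := sub_eq_zero.1 h
    exact hne' (by
      congr 1
      funext j
      simpa [f] using congr_fun heq j)
  · have h := congr_fun heq ⟨j, by omega⟩
    simp only [f] at h
    refine mem_sub.2 ⟨b' ⟨j, by omega⟩, hab'.2 _, b ⟨j, by omega⟩, hab.2 _, ?_⟩
    rw [nsmul_sub, sub_eq_sub_iff_add_eq_add, add_comm, ← h, add_comm]

open Finset in
open scoped Classical in
theorem card_add_add_sub_le {G : Type*} [AddCommGroup G] {A : Finset G} {K : ℝ}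
    (hne : A.Nonempty) (hA : (#(A + A) : ℝ) ≤ K * #A) :
    (#(A + A + (A - A)) : ℝ) ≤ K ^ 4 * #A := by
  have hpos : (0 : ℝ) < #A := by exact_mod_cast hne.card_pos
  have h := pluennecke_ruzsa_inequality_nsmul_sub_nsmul_add hne A 3 1
  rw [succ_nsmul, two_nsmul, one_nsmul, add_sub_assoc] at h
  have h' := NNRat.cast_le (K := ℝ).2 h
  push_cast at h'
  refine h'.trans ?_
  gcongr
  rwa [div_le_iff₀ hpos]

open Finset in
open scoped Classical in
theorem card_image_mul_le_card_add {G H : Type*} [AddCommGroup G] [IsAddTorsionFree G]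
    [AddCommGroup H] (π : G →+ H) {v : G} (hv : v ≠ 0) (hπv : π v = 0) {L : ℕ}
    (S P : Finset G) (hP : ∀ j ≤ L, j • v ∈ P) :
    #(S.image π) * (L + 1) ≤ #(S + P) := by
  have hs : ∀ x ∈ S.image π, ∃ s ∈ S, π s = x := fun x hx ↦ by simpa using hx
  choose! s hsS hsπ using hs
  rw [← card_range (L + 1), ← card_product]
  refine card_le_card_of_injOn (fun p ↦ s p.1 + p.2 • v) ?_ ?_
  · rintro ⟨x, j⟩ hp
    simp only [coe_product, Set.mem_prod, mem_coe, mem_range] at hp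
    exact add_mem_add (hsS _ hp.1) (hP _ (by omega))
  · rintro ⟨x, j⟩ hp ⟨y, k⟩ hq h
    simp only [coe_product, Set.mem_prod, mem_coe] at hp hq h
    have hxy : x = y := by
      have := congr_arg π h
      simpa [hπv, hsπ _ hp.1, hsπ _ hq.1] using this
    subst hxy
    simp only [add_right_inj] at h
    rw [injective_nsmul_iff_not_isOfFinAddOrder.2
      (not_isOfFinAddOrder_of_isAddTorsionFree hv) h]

section Fibres

variable {G H : Type*} [AddCommGroup G] [AddCommGroup H]

open Finset in
open scoped Classical in
/-- The number of elements of `A` in the fibre of `π` over `x`. -/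
noncomputable def fibreCard (π : G →+ H) (A : Finset G) (x : H) : ℕ := #{a ∈ A | π a = x}

open Finset in
open scoped Classical in
/-- The points over which `A` has at least `t` elements. -/
noncomputable def fibreLevel (π : G →+ H) (A : Finset G) (t : ℕ) : Finset H :=
  {x ∈ A.image π | t ≤ fibreCard π A x}

open Finset in
open scoped Classical in
theorem sum_fibreCard (π : G →+ H) (A : Finset G) :
    ∑ x ∈ A.image π, fibreCard π A x = #A :=
  (card_eq_sum_card_image π A).symm

open Finset in
open scoped Classical in
theorem fibreCard_pos {π : G →+ H} {A : Finset G} {x : H} (hx : x ∈ A.image π) :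
    0 < fibreCard π A x := by
  obtain ⟨a, ha, rfl⟩ := mem_image.1 hx
  exact card_pos.2 ⟨a, by simpa using ha⟩

open Finset in
open scoped Classical in
theorem fibreCard_add_le [IsAddTorsionFree G] {π : G →+ H} {A : Finset G} {x y : H}
    (hx : x ∈ A.image π) (hy : y ∈ A.image π) :
    fibreCard π A x + fibreCard π A y ≤ fibreCard π (A + A) (x + y) + 1 := by
  have h := cauchy_davenport_of_isAddTorsionFree (card_pos.1 (fibreCard_pos hx))
    (card_pos.1 (fibreCard_pos hy))
  have h2 : #({a ∈ A | π a = x} + {a ∈ A | π a = y}) ≤ fibreCard π (A + A) (x + y) := by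
    refine card_le_card fun z hz ↦ ?_
    obtain ⟨a, ha, b, hb, rfl⟩ := mem_add.1 hz
    rw [mem_filter] at ha hb ⊢
    exact ⟨add_mem_add ha.1 hb.1, by rw [map_add, ha.2, hb.2]⟩
  unfold fibreCard at *
  omega

open Finset in
open scoped Classical in
theorem sum_card_fibreLevel (π : G →+ H) (A : Finset G) {T : ℕ}
    (hT : ∀ x, fibreCard π A x ≤ T) :
    ∑ t ∈ Icc 1 T, #(fibreLevel π A t) = #A := by
  rw [← sum_fibreCard π A]
  simp only [fibreLevel, card_filter]
  rw [sum_comm]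
  refine sum_congr rfl fun x _ ↦ ?_
  rw [← card_filter]
  have : {t ∈ Icc 1 T | t ≤ fibreCard π A x} = Icc 1 (fibreCard π A x) := by
    ext t
    have := hT x
    simp only [mem_filter, mem_Icc]
    omega
  simp [this]

open Finset in
open scoped Classical in
theorem two_mul_sum_card_fibreLevel_add_le [IsAddTorsionFree G] (π : G →+ H) (A : Finset G)
    (T : ℕ) :
    2 * ∑ t ∈ Icc 1 T, #(fibreLevel π A t + fibreLevel π A t) ≤
      #(A + A) + #((A + A).image π) := by
  have h1 : ∀ t, #(fibreLevel π A t + fibreLevel π A t) ≤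
      #{z ∈ (A + A).image π | 2 * t ≤ fibreCard π (A + A) z + 1} := by
    refine fun t ↦ card_le_card fun z hz ↦ ?_
    obtain ⟨x, hx, y, hy, rfl⟩ := mem_add.1 hz
    simp only [fibreLevel, mem_filter] at hx hy ⊢
    refine ⟨?_, ?_⟩
    · rw [image_add]
      exact add_mem_add hx.1 hy.1
    · have := fibreCard_add_le hx.1 hy.1
      omega
  calc 2 * ∑ t ∈ Icc 1 T, #(fibreLevel π A t + fibreLevel π A t)
      ≤ 2 * ∑ t ∈ Icc 1 T, #{z ∈ (A + A).image π | 2 * t ≤ fibreCard π (A + A) z + 1} := by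
        exact Nat.mul_le_mul_left 2 (sum_le_sum fun t _ ↦ h1 t)
    _ = ∑ z ∈ (A + A).image π, 2 * #{t ∈ Icc 1 T | 2 * t ≤ fibreCard π (A + A) z + 1} := by
        simp only [card_filter]
        rw [sum_comm, mul_sum]
    _ ≤ ∑ z ∈ (A + A).image π, (fibreCard π (A + A) z + 1) := by
        refine sum_le_sum fun z _ ↦ ?_
        have : #{t ∈ Icc 1 T | 2 * t ≤ fibreCard π (A + A) z + 1} ≤
            #(Icc 1 ((fibreCard π (A + A) z + 1) / 2)) := by
          refine card_le_card fun t ht ↦ ?_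
          simp only [mem_filter, mem_Icc] at ht ⊢
          omega
        rw [Nat.card_Icc] at this
        omega
    _ = _ := by rw [sum_add_distrib, sum_fibreCard]; simp

open Finset in
open scoped Classical in
theorem exists_fibreCard_le [IsAddTorsionFree G] (π : G →+ H) {A : Finset G}
    (hA : A.Nonempty) :
    ∃ T : ℕ, (∀ x, fibreCard π A x ≤ T) ∧ T * #(A.image π) ≤ #(A + A) := by
  obtain ⟨x, hx, hmax⟩ := exists_max_image (A.image π) (fibreCard π A) (hA.image π)
  refine ⟨fibreCard π A x, fun y ↦ ?_, ?_⟩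
  · by_cases hy : y ∈ A.image π
    · exact hmax y hy
    · have : fibreCard π A y = 0 := by
        refine card_eq_zero.2 (filter_eq_empty_iff.2 fun a ha h ↦ hy ?_)
        exact h ▸ mem_image_of_mem π ha
      omega
  · calc fibreCard π A x * #(A.image π) = ∑ _y ∈ A.image π, fibreCard π A x := by
          simp [mul_comm]
      _ ≤ ∑ y ∈ A.image π, fibreCard π (A + A) (x + y) := by
          refine sum_le_sum fun y hy ↦ ?_
          have := fibreCard_add_le hx hy
          have := fibreCard_pos hy
          omega
      _ = ∑ z ∈ (A.image π).image (x + ·), fibreCard π (A + A) z := by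
          rw [sum_image fun a _ b _ h ↦ add_left_cancel h]
      _ ≤ ∑ z ∈ (A + A).image π, fibreCard π (A + A) z := by
          refine sum_le_sum_of_subset fun z hz ↦ ?_
          obtain ⟨y, hy, rfl⟩ := mem_image.1 hz
          rw [image_add]
          exact add_mem_add hx hy
      _ = #(A + A) := sum_fibreCard π _

open Finset in
open scoped Classical in
theorem mul_card_fibreLevel_filter_le (π : G →+ H) (A : Finset G) (t : ℕ) (p : H → Prop) :
    t * #{x ∈ fibreLevel π A t | p x} ≤ #{a ∈ A | p (π a)} := by
  calc t * #{x ∈ fibreLevel π A t | p x}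
      = ∑ x ∈ fibreLevel π A t with p x, t := by simp [mul_comm]
    _ ≤ ∑ x ∈ fibreLevel π A t with p x, #{a ∈ {a ∈ A | p (π a)} | π a = x} := by
        refine sum_le_sum fun x hx ↦ ?_
        simp only [fibreLevel, mem_filter] at hx
        refine hx.1.2.trans (card_le_card fun a ha ↦ ?_)
        simp only [mem_filter] at ha ⊢
        exact ⟨⟨ha.1, ha.2 ▸ hx.2⟩, ha.2⟩
    _ ≤ #{a ∈ A | p (π a)} :=
        (sum_card_fiberwise_eq_card_filter _ _ π).trans_le (card_filter_le _ _)

end Fibres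

open Finset in
theorem sum_le_of_mul_le {e : ℕ → ℝ} {B : Finset ℕ} {a e₁ K θ : ℝ} {T : ℕ} (ha : 0 < a)
    (he₁ : 0 < e₁) (hK : 0 < K) (hθ : 0 < θ) (hT : T * e₁ ≤ K * a) (hB : B ⊆ Icc 1 T)
    (hle : ∀ t ∈ B, e t ≤ e₁) (hmul : ∀ t ∈ B, t * e t ≤ θ ^ 2 / K * a) :
    ∑ t ∈ B, e t ≤ 2 * θ * a := by
  classical
  rw [← sum_filter_add_sum_filter_not B fun t ↦ (t : ℝ) * e₁ ≤ θ * a]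
  have h1 : ∑ t ∈ B.filter (fun t : ℕ ↦ (t : ℝ) * e₁ ≤ θ * a), e t ≤ θ * a := by
    have hsub : (B.filter fun t : ℕ ↦ (t : ℝ) * e₁ ≤ θ * a) ⊆ Icc 1 ⌊θ * a / e₁⌋₊ := by
      intro t ht
      rw [mem_filter] at ht
      rw [mem_Icc]
      exact ⟨(mem_Icc.1 (hB ht.1)).1, Nat.le_floor ((le_div_iff₀ he₁).2 ht.2)⟩
    calc ∑ t ∈ B.filter (fun t : ℕ ↦ (t : ℝ) * e₁ ≤ θ * a), e t
        ≤ #(B.filter fun t : ℕ ↦ (t : ℝ) * e₁ ≤ θ * a) • e₁ :=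
          sum_le_card_nsmul _ _ _ fun t ht ↦ hle t (mem_filter.1 ht).1
      _ ≤ ⌊θ * a / e₁⌋₊ * e₁ := by
          rw [nsmul_eq_mul]
          gcongr
          simpa using card_le_card hsub
      _ ≤ θ * a / e₁ * e₁ := by
          gcongr
          exact Nat.floor_le (by positivity)
      _ = θ * a := by field_simp
  have h2 : ∑ t ∈ B.filter (fun t : ℕ ↦ ¬ (t : ℝ) * e₁ ≤ θ * a), e t ≤ θ * a := by
    calc ∑ t ∈ B.filter (fun t : ℕ ↦ ¬ (t : ℝ) * e₁ ≤ θ * a), e t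
        ≤ #(B.filter fun t : ℕ ↦ ¬ (t : ℝ) * e₁ ≤ θ * a) • (θ / K * e₁) := by
          refine sum_le_card_nsmul _ _ _ fun t ht ↦ ?_
          rw [mem_filter, not_le] at ht
          have ht0 : (0 : ℝ) < t := by exact_mod_cast (mem_Icc.1 (hB ht.1)).1
          refine le_of_mul_le_mul_left ?_ ht0
          calc t * e t ≤ θ ^ 2 / K * a := hmul t ht.1
            _ = θ / K * (θ * a) := by ring
            _ ≤ θ / K * (t * e₁) := mul_le_mul_of_nonneg_left ht.2.le (by positivity)
            _ = t * (θ / K * e₁) := by ring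
      _ ≤ T * (θ / K * e₁) := by
          rw [nsmul_eq_mul]
          gcongr
          simpa using card_le_card ((filter_subset _ _).trans hB)
      _ = θ / K * (T * e₁) := by ring
      _ ≤ θ / K * (K * a) := by gcongr
      _ = θ * a := by field_simp
  linarith

theorem finrank_comap_mkQ_span_singleton_le {E : Type*} [AddCommGroup E] [Module ℝ E]
    [FiniteDimensional ℝ E] (v : E) (U : Submodule ℝ (E ⧸ Submodule.span ℝ {v})) :
    Module.finrank ℝ (U.comap (Submodule.span ℝ {v}).mkQ) ≤ Module.finrank ℝ U + 1 := by
  let N := Submodule.span ℝ {v}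
  let f := N.mkQ.submoduleComap U
  have h := f.finrank_range_add_finrank_ker
  have h1 : Module.finrank ℝ (LinearMap.range f) ≤ Module.finrank ℝ U := Submodule.finrank_le _
  have h2 : Module.finrank ℝ (LinearMap.ker f) ≤ Module.finrank ℝ N := by
    refine LinearMap.finrank_le_finrank_of_injective
      (f := ((U.comap N.mkQ).subtype.comp (LinearMap.ker f).subtype).codRestrict N ?_) ?_
    · rintro ⟨⟨x, hx⟩, hx'⟩
      have := congr_arg Subtype.val (LinearMap.mem_ker.1 hx')
      simpa [f] using this
    · intro x y hxy
      have := congr_arg Subtype.val hxy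
      exact Subtype.ext (Subtype.ext this)
  have h3 : Module.finrank ℝ N ≤ 1 := by
    simpa using finrank_span_le_card (R := ℝ) ({v} : Set E)
  change Module.finrank ℝ (U.comap N.mkQ) ≤ _
  omega

universe u

open Finset in
open scoped Classical in
/-- A finite set that does not concentrate on affine subspaces of dimension less than `D` has
doubling constant at least `2 ^ D - δ`. -/
theorem exists_two_pow_sub_mul_card_le_card_add (D : ℕ) : ∀ δ : ℝ, 0 < δ → ∃ c : ℝ, 0 < c ∧
    ∀ (E : Type u) [AddCommGroup E] [Module ℝ E] [FiniteDimensional ℝ E] (A : Finset E),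
      (∀ (U : Submodule ℝ E) (w : E), Module.finrank ℝ U < D →
        (#{a ∈ A | a - w ∈ U} : ℝ) ≤ c * #A) →
      (2 ^ D - δ) * #A ≤ #(A + A) := by
  induction D with
  | zero =>
    refine fun δ hδ ↦ ⟨1, one_pos, fun E _ _ _ A _ ↦ ?_⟩
    have h : (#A : ℝ) ≤ #(A + A) := by exact_mod_cast card_le_card_add_self
    nlinarith [Nat.cast_nonneg (α := ℝ) #A]
  | succ D ih =>
    intro δ hδ
    set K : ℝ := 2 ^ (D + 1) with hKdef
    have hK : 1 ≤ K := one_le_pow₀ one_le_two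
    obtain ⟨c, hc, hind⟩ := ih (δ / 8) (by positivity)
    set θ : ℝ := δ / (8 * K) with hθdef
    have hθ : 0 < θ := by positivity
    obtain ⟨L, hL⟩ := exists_nat_ge (4 * K ^ 4 / δ)
    set M : ℝ := (K ^ (L + 1)) ^ (L + 1)
    have hM : 0 < M := by positivity
    refine ⟨min (θ ^ 2 / K * c) (1 / (2 * M)), by positivity, fun E _ _ _ A hA ↦ ?_⟩
    obtain rfl | hne := A.eq_empty_or_nonempty
    · simp
    have ha : (0 : ℝ) < #A := by exact_mod_cast hne.card_pos
    by_contra! hlt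
    have hdoub : (#(A + A) : ℝ) ≤ K * #A := hlt.le.trans (by gcongr; linarith)
    have hMA : M < #A := by
      obtain ⟨a, haA⟩ := hne
      have h1 : (1 : ℝ) ≤ #{x ∈ A | x - a ∈ (⊥ : Submodule ℝ E)} := by
        exact_mod_cast card_pos.2 ⟨a, by simpa using haA⟩
      have h2 := h1.trans (hA ⊥ a (by simp))
      have h3 : 1 ≤ 1 / (2 * M) * #A := h2.trans (by gcongr; exact min_le_right _ _)
      rw [one_div_mul_eq_div, one_le_div (by positivity)] at h3
      linarith
    obtain ⟨v, hv, hvA⟩ := exists_ne_zero_forall_nsmul_mem_sub hK hdoub L hMA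
    set N := Submodule.span ℝ {v}
    let π : E →+ E ⧸ N := N.mkQ.toAddMonoidHom
    have hπ : ∀ x, π x = N.mkQ x := fun _ ↦ rfl
    have hπv : π v = 0 := by
      rw [hπ, Submodule.mkQ_apply, Submodule.Quotient.mk_eq_zero]
      exact Submodule.mem_span_singleton_self v
    have : IsAddTorsionFree E := .of_isTorsionFree ℝ E
    have hlines : (#((A + A).image π) : ℝ) ≤ δ / 4 * #A := by
      have h1 : (#((A + A).image π) : ℝ) * (L + 1) ≤ K ^ 4 * #A := by
        refine le_trans ?_ (card_add_add_sub_le hne hdoub)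
        exact_mod_cast card_image_mul_le_card_add π hv hπv (A + A) (A - A) hvA
      rw [div_le_iff₀ hδ] at hL
      refine le_of_mul_le_mul_right (h1.trans ?_) (by positivity : (0 : ℝ) < L + 1)
      nlinarith
    obtain ⟨T, hT, hTA⟩ := exists_fibreCard_le π hne
    have hsum := sum_card_fibreLevel π A hT
    have htwo := two_mul_sum_card_fibreLevel_add_le π A T
    let good : ℕ → Prop := fun t ↦ (2 ^ D - δ / 8) * (#(fibreLevel π A t) : ℝ) ≤
      #(fibreLevel π A t + fibreLevel π A t)
    have hbad : ∑ t ∈ Icc 1 T with ¬ good t, (#(fibreLevel π A t) : ℝ) ≤ 2 * θ * #A := by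
      refine sum_le_of_mul_le (e₁ := #(A.image π)) (K := K) (T := T) ha
        (by exact_mod_cast (hne.image π).card_pos) (by positivity) hθ ?_ (filter_subset _ _)
        (fun t _ ↦ by exact_mod_cast card_le_card (filter_subset _ _)) fun t ht ↦ ?_
      · exact le_trans (by exact_mod_cast hTA) hdoub
      · have hng := mt (hind (E ⧸ N) (fibreLevel π A t)) (mem_filter.1 ht).2
        push Not at hng
        obtain ⟨U, w, hU, hUw⟩ := hng
        obtain ⟨w, rfl⟩ := N.mkQ_surjective w
        have h1 := hA (U.comap N.mkQ) w
          ((finrank_comap_mkQ_span_singleton_le v U).trans_lt (Nat.succ_lt_succ hU))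
        have h2 : ((t * #{x ∈ fibreLevel π A t | x - N.mkQ w ∈ U} : ℕ) : ℝ) ≤
            #{a ∈ A | π a - N.mkQ w ∈ U} :=
          Nat.cast_le.2 (mul_card_fibreLevel_filter_le π A t fun x ↦ x - N.mkQ w ∈ U)
        push_cast at h2
        simp only [Submodule.mem_comap, map_sub] at h1
        refine le_of_mul_le_mul_left ?_ hc
        calc c * (t * #(fibreLevel π A t)) = t * (c * #(fibreLevel π A t)) := by ring
          _ ≤ t * #{x ∈ fibreLevel π A t | x - N.mkQ w ∈ U} := by gcongr
          _ ≤ _ := h2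
          _ ≤ _ := h1
          _ ≤ θ ^ 2 / K * c * #A := by gcongr; exact min_le_left _ _
          _ = c * (θ ^ 2 / K * #A) := by ring
    have hlow : ∀ t, (2 ^ D - δ / 8) * (#(fibreLevel π A t) : ℝ) -
        (if good t then 0 else 2 ^ D * (#(fibreLevel π A t) : ℝ)) ≤
          #(fibreLevel π A t + fibreLevel π A t) := by
      intro t
      split_ifs with h
      · simpa [good] using h
      · have : 0 ≤ δ / 8 * (#(fibreLevel π A t) : ℝ) := by positivity
        have : (0 : ℝ) ≤ #(fibreLevel π A t + fibreLevel π A t) := by positivity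
        linarith
    have htot := sum_le_sum fun t (_ : t ∈ Icc 1 T) ↦ hlow t
    have hsum' : ∑ t ∈ Icc 1 T, (#(fibreLevel π A t) : ℝ) = #A := by exact_mod_cast hsum
    have hbad' : ∑ t ∈ Icc 1 T, (if good t then 0 else 2 ^ D * (#(fibreLevel π A t) : ℝ)) =
        2 ^ D * ∑ t ∈ Icc 1 T with ¬ good t, (#(fibreLevel π A t) : ℝ) := by
      rw [sum_filter, mul_sum]
      exact sum_congr rfl fun t _ ↦ by split_ifs <;> simp
    rw [sum_sub_distrib, ← mul_sum, hsum', hbad'] at htot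
    have htwo' : 2 * ∑ t ∈ Icc 1 T, (#(fibreLevel π A t + fibreLevel π A t) : ℝ) ≤
        #(A + A) + #((A + A).image π) := by exact_mod_cast htwo
    have hKD : K = 2 * 2 ^ D := by rw [hKdef, pow_succ, mul_comm]
    have hKbad : K * ∑ t ∈ Icc 1 T with ¬ good t, (#(fibreLevel π A t) : ℝ) ≤ δ / 4 * #A :=
      calc _ ≤ K * (2 * θ * #A) := by gcongr
        _ = δ / 4 * #A := by rw [hθdef]; field_simp; norm_num
    rw [hKD] at hKbad hlt
    have : 0 < δ * (#A : ℝ) := by positivity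
    linarith

/-- The Freiman–Bilu lemma: a finite subset of `ℝ^d` with doubling at most `K` has a
proportion `≥ c(ε,K)` subset contained in an affine subspace of dimension at most
`log₂ K + ε`, uniformly in `d`. -/
theorem freiman_bilu_lemma (ε K : ℝ) (hε : 0 < ε) (hK : 1 ≤ K) :
    ∃ c : ℝ, 0 < c ∧
      ∀ d : ℕ, 0 < d →
        ∀ A : Set (Fin d → ℝ), A.Finite → A.Nonempty →
          ((A + A).ncard : ℝ) ≤ K * A.ncard →
          ∃ A' ⊆ A, c * A.ncard ≤ (A'.ncard : ℝ) ∧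
            ∃ W : AffineSubspace ℝ (Fin d → ℝ),
              (Module.finrank ℝ W.direction : ℝ) ≤ Real.logb 2 K + ε ∧
              A' ⊆ (W : Set (Fin d → ℝ)) := by
  classical
  have hlog : 0 ≤ Real.logb 2 K + ε := by
    have := Real.logb_nonneg one_lt_two hK
    linarith
  set m := ⌊Real.logb 2 K + ε⌋₊
  have hKm : K < 2 ^ (m + 1) := by
    rw [← Real.rpow_natCast, ← Real.logb_lt_iff_lt_rpow one_lt_two (by linarith)]
    have := Nat.lt_floor_add_one (Real.logb 2 K + ε)
    push_cast
    linarith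
  obtain ⟨c, hc, h⟩ := exists_two_pow_sub_mul_card_le_card_add (m + 1) ((2 ^ (m + 1) - K) / 2)
    (by linarith)
  refine ⟨c, hc, fun d _ A hA hne hdoub ↦ ?_⟩
  lift A to Finset (Fin d → ℝ) using hA
  rw [← Finset.coe_add, Set.ncard_coe_finset, Set.ncard_coe_finset] at hdoub
  have ha : (0 : ℝ) < A.card := by exact_mod_cast (Finset.coe_nonempty.1 hne).card_pos
  have hcon := mt (h (Fin d → ℝ) A) (by
    rw [not_le]
    refine lt_of_le_of_lt (le_trans (le_of_eq ?_) hdoub) ?_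
    · congr!
    · gcongr
      linarith)
  push Not at hcon
  obtain ⟨U, w, hU, hcard⟩ := hcon
  refine ⟨{a | a ∈ A ∧ a - w ∈ U}, fun a ha ↦ ha.1, ?_, AffineSubspace.mk' w U, ?_, ?_⟩
  · rw [Set.ncard_coe_finset]
    refine hcard.le.trans (le_of_eq ?_)
    rw [← Set.ncard_coe_finset]
    congr 2
    ext
    simp
  · rw [AffineSubspace.direction_mk']
    exact (Nat.le_floor_iff hlog).1 (Nat.lt_succ_iff.1 hU)
  · intro a ha
    simpa [AffineSubspace.mem_mk'] using ha.2
end
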